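/- Suppose T satisfies the mixing local limit theorem (MLLT) at some scale (L_n). Then T is local-global mixing with respect to 𝔾_O: for every φ ∈ L¹(μ) and every pair (Φ, Φ̄) ∈ 𝔾_O, ∫_X φ · (Φ ∘ T^n) dμ → (∫_X φ dμ) · Φ̄ as n → ∞. -/

import Mathlib

open MeasureTheory Filter Topology

noncomputable section

/-- Euclidean norm of a vector in `ℝ^d`. -/
def rnorm {d : ℕ} (z : Fin d → ℝ) : ℝ := Real.sqrt (∑ i, (z i) ^ 2)

/-- Euclidean norm of a lattice point in `ℤ^d`. -/
def znorm {d : ℕ} (z : Fin d → ℤ) : ℝ := rnorm (fun i => (z i : ℝ))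

variable {d : ℕ} {M : Type*}

/-- The Birkhoff sums `τ_n(y) = ∑_{j<n} τ(f^j y)`. -/
def tauSum (f : M → M) (τ : M → Fin d → ℤ) (n : ℕ) (y : M) : Fin d → ℤ :=
  ∑ j ∈ Finset.range n, τ (f^[j] y)

/-- The skew product `T(y,z) = (f(y), z + τ(y))` on `X = M × ℤ^d`. -/
def skewT (f : M → M) (τ : M → Fin d → ℤ) : M × (Fin d → ℤ) → M × (Fin d → ℤ) :=
  fun x => (f x.1, x.2 + τ x.1)

/-- The measure `μ = ν ⊗ (counting measure on ℤ^d)` on `X = M × ℤ^d`. -/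
def skewMeas [MeasurableSpace M] (ν : Measure M) : Measure (M × (Fin d → ℤ)) :=
  ν.prod (Measure.count : Measure (Fin d → ℤ))

/-- `V_B = M × (B ∩ ℤ^d)` for the box `B = ∏_i [a i, b i] ⊆ ℝ^d`. -/
def VBox (M : Type*) (a b : Fin d → ℝ) : Set (M × (Fin d → ℤ)) :=
  {x | ∀ i, a i ≤ (x.2 i : ℝ) ∧ (x.2 i : ℝ) ≤ b i}

/-- `V_C` for the cube `C` with lower corner `a` and side length `s`. -/
def VCube (M : Type*) (a : Fin d → ℝ) (s : ℝ) : Set (M × (Fin d → ℤ)) :=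
  VBox M a (fun i => a i + s)

/-- Membership in `𝔾_O`:  `Φ` is bounded, uniformly continuous, and has average `Φbar`
along dilations of any fixed box. -/
def memGO [MetricSpace M] [MeasurableSpace M] (μ : Measure (M × (Fin d → ℤ)))
    (Φ : M × (Fin d → ℤ) → ℝ) (Φbar : ℝ) : Prop :=
  (∃ C, ∀ x, |Φ x| ≤ C) ∧ UniformContinuous Φ ∧
    ∀ a b : Fin d → ℝ, (∀ i, a i < b i) →
      Tendsto (fun N : ℝ =>
          (1 / (N ^ d * ∏ i, (b i - a i))) *
            ∫ x in VBox M (fun i => a i * N) (fun i => b i * N), Φ x ∂μ)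
        atTop (𝓝 Φbar)

/-- Membership in `𝔾_U`: `Φ` is bounded, uniformly continuous, and has average `Φbar`
uniformly over all large cubes. -/
def memGU [MetricSpace M] [MeasurableSpace M] (μ : Measure (M × (Fin d → ℤ)))
    (Φ : M × (Fin d → ℤ) → ℝ) (Φbar : ℝ) : Prop :=
  (∃ C, ∀ x, |Φ x| ≤ C) ∧ UniformContinuous Φ ∧
    ∀ ε > (0 : ℝ), ∃ N₀ : ℝ, ∀ (a : Fin d → ℝ) (s : ℝ), N₀ ≤ s →
      |(μ (VCube M a s)).toReal⁻¹ * (∫ x in VCube M a s, Φ x ∂μ) - Φbar| ≤ ε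

/-- The average of `F` over `V_C`, where the cube `C` is encoded by (lower corner, side length). -/
def cubeAvg [MeasurableSpace M] (μ : Measure (M × (Fin d → ℤ)))
    (F : M × (Fin d → ℤ) → ℝ) (c : (Fin d → ℝ) × ℝ) : ℝ :=
  (μ (VCube M c.1 c.2)).toReal⁻¹ * ∫ x in VCube M c.1 c.2, F x ∂μ

/-- The filter of cubes (encoded by (lower corner, side length)) whose side length
tends to infinity. -/
def cubeFilter (d : ℕ) : Filter ((Fin d → ℝ) × ℝ) := Filter.comap Prod.snd atTop

/-- The mixing local limit theorem (MLLT) at scale `L` with limiting density `p`. -/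
def MLLT [TopologicalSpace M] [MeasurableSpace M] (ν : Measure M) (f : M → M) (τ : M → Fin d → ℤ)
    (L : ℕ → ℝ) (p : (Fin d → ℝ) → ℝ) : Prop :=
  Tendsto L atTop atTop ∧ Continuous p ∧ (∀ z, 0 ≤ p z) ∧ (∫ z : Fin d → ℝ, p z) = 1 ∧
    ∀ φ₁ φ₂ : M → ℝ, Continuous φ₁ → Continuous φ₂ →
      (∃ C, ∀ y, |φ₁ y| ≤ C) → (∃ C, ∀ y, |φ₂ y| ≤ C) →
      ∀ z0 : ℕ → Fin d → ℤ,
        Tendsto (fun n => fun i => (z0 n i : ℝ) / L n) atTop (𝓝 0) →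
      ∀ K : ℝ, ∀ ε > (0 : ℝ), ∃ N, ∀ n ≥ N, ∀ z : Fin d → ℝ, rnorm z ≤ K →
        |(L n) ^ d *
            (∫ y, (if tauSum f τ n y = z0 n + (fun i => ⌊z i * L n⌋) then
              φ₁ y * φ₂ (f^[n] y) else 0) ∂ν) -
          (∫ y, φ₁ y ∂ν) * (∫ y, φ₂ y ∂ν) * p z| ≤ ε

/-- The shifted mixing local limit theorem at scale `L` with limiting density `p`. -/
def ShiftedMLLT [TopologicalSpace M] [MeasurableSpace M] (ν : Measure M) (f : M → M) (τ : M → Fin d → ℤ)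
    (L : ℕ → ℝ) (p : (Fin d → ℝ) → ℝ) : Prop :=
  Tendsto L atTop atTop ∧ Continuous p ∧ (∀ z, 0 ≤ p z) ∧ (∫ z : Fin d → ℝ, p z) = 1 ∧
    ∃ D : ℕ → Fin d → ℝ,
    ∀ φ₁ φ₂ : M → ℝ, Continuous φ₁ → Continuous φ₂ →
      (∃ C, ∀ y, |φ₁ y| ≤ C) → (∃ C, ∀ y, |φ₂ y| ≤ C) →
      ∀ z0 : ℕ → Fin d → ℤ,
        Tendsto (fun n => fun i => ((z0 n i : ℝ) - D n i) / L n) atTop (𝓝 0) →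
      ∀ K : ℝ, ∀ ε > (0 : ℝ), ∃ N, ∀ n ≥ N, ∀ z : Fin d → ℝ, rnorm z ≤ K →
        |(L n) ^ d *
            (∫ y, (if tauSum f τ n y = z0 n + (fun i => ⌊z i * L n⌋) then
              φ₁ y * φ₂ (f^[n] y) else 0) ∂ν) -
          (∫ y, φ₁ y ∂ν) * (∫ y, φ₂ y ∂ν) * p z| ≤ ε

end

section UncountableImage

open Set CantorScheme PiNat

/-- An open set with uncountable image splits into two small open sets with uncountable, disjoint
images. -/
theorem exists_disjoint_image_of_not_countable_image {X Y : Type*} [MetricSpace X]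
    [SecondCountableTopology X] [TopologicalSpace Y] [T2Space Y] {g : X → Y} (hg : Continuous g)
    {U : Set X} (hU : IsOpen U) (hunc : ¬ (g '' U).Countable) {ε : ENNReal} (hε : 0 < ε) :
    ∃ U₀ U₁ : Set X,
      (IsOpen U₀ ∧ ¬ (g '' U₀).Countable ∧ closure U₀ ⊆ U ∧ Metric.ediam U₀ ≤ ε) ∧
      (IsOpen U₁ ∧ ¬ (g '' U₁).Countable ∧ closure U₁ ⊆ U ∧ Metric.ediam U₁ ≤ ε) ∧
      Disjoint (g '' U₀) (g '' U₁) := by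
  set W : Set X := {x | ∃ V ∈ 𝓝 x, (g '' V).Countable} with hW
  have hsmall : (g '' (U ∩ W)).Countable := by
    choose! V hV hVc using fun x (hx : x ∈ W) => hx
    obtain ⟨t, hts, htc, ht⟩ := TopologicalSpace.countable_cover_nhdsWithin (s := U ∩ W) (f := V)
      fun x hx => mem_nhdsWithin_of_mem_nhds (hV x hx.2)
    refine Countable.mono (image_mono ht) ?_
    rw [image_iUnion₂]
    exact htc.biUnion fun x hx => hVc x (hts hx).2
  have hbig : ¬ (g '' (U \ W)).Countable := fun h => hunc <| by
    rw [← inter_union_sdiff U W, image_union]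
    exact hsmall.union h
  have hnt : (g '' (U \ W)).Nontrivial := by
    by_contra h
    exact hbig (not_nontrivial_iff.1 h).countable
  obtain ⟨_, ⟨x, hx, rfl⟩, _, ⟨y, hy, rfl⟩, hxy⟩ := hnt
  obtain ⟨A, B, hA, hB, hxA, hyB, hAB⟩ := t2_separation hxy
  have key : ∀ z ∈ U \ W, ∀ C : Set Y, IsOpen C → g z ∈ C → ∃ V : Set X,
      (IsOpen V ∧ ¬ (g '' V).Countable ∧ closure V ⊆ U ∧ Metric.ediam V ≤ ε) ∧ g '' V ⊆ C := by
    intro z hz C hC hzC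
    have hmem : U ∩ g ⁻¹' C ∩ Metric.closedEBall z (ε / 2) ∈ 𝓝 z :=
      inter_mem (inter_mem (hU.mem_nhds hz.1) (hg.continuousAt.preimage_mem_nhds (hC.mem_nhds hzC)))
        (Metric.closedEBall_mem_nhds _ (ENNReal.half_pos hε.ne'))
    obtain ⟨r, hr, hrs⟩ := Metric.nhds_basis_closedBall.mem_iff.1 hmem
    refine ⟨Metric.ball z r, ⟨Metric.isOpen_ball, fun h => hz.2 ⟨_, Metric.ball_mem_nhds z hr, h⟩,
      Metric.closure_ball_subset_closedBall.trans fun w hw => (hrs hw).1.1, ?_⟩, ?_⟩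
    · refine (Metric.ediam_mono (Metric.ball_subset_closedBall.trans
        (hrs.trans inter_subset_right))).trans ?_
      refine Metric.ediam_closedEBall_le.trans ?_
      rw [ENNReal.mul_div_cancel] <;> simp
    · rintro _ ⟨w, hw, rfl⟩
      exact (hrs (Metric.ball_subset_closedBall hw)).1.2
  obtain ⟨V₀, h₀, hV₀⟩ := key x hx A hA hxA
  obtain ⟨V₁, h₁, hV₁⟩ := key y hy B hB hyB
  exact ⟨V₀, V₁, h₀, h₁, hAB.mono hV₀ hV₁⟩

/-- A continuous map from a Polish space with uncountable range is injective on a copy of the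
Cantor space. -/
theorem exists_nat_bool_injective_comp {X Y : Type*} [TopologicalSpace X] [PolishSpace X]
    [TopologicalSpace Y] [T2Space Y] {g : X → Y} (hg : Continuous g)
    (hunc : ¬ (range g).Countable) :
    ∃ φ : (ℕ → Bool) → X, Continuous φ ∧ Function.Injective (g ∘ φ) := by
  let := TopologicalSpace.upgradeIsCompletelyMetrizable X
  obtain ⟨u, -, upos', hu⟩ := exists_seq_strictAnti_tendsto' (zero_lt_one' ENNReal)
  have upos := fun n => (upos' n).1
  let P := Subtype fun E : Set X => IsOpen E ∧ ¬ (g '' E).Countable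
  choose C0 C1 h0 h1 hdisj using
    fun {C : Set X} (hC : IsOpen C) (hunc : ¬ (g '' C).Countable) {ε : ENNReal} (hε : 0 < ε) =>
    exists_disjoint_image_of_not_countable_image hg hC hunc hε
  let DP : List Bool → P := fun l => by
    induction l with
    | nil => exact ⟨univ, isOpen_univ, by rwa [image_univ]⟩
    | cons a l ih =>
      cases a
      · use C0 ih.property.1 ih.property.2 (upos (l.length + 1))
        exact ⟨(h0 _ _ _).1, (h0 _ _ _).2.1⟩
      use C1 ih.property.1 ih.property.2 (upos (l.length + 1))
      exact ⟨(h1 _ _ _).1, (h1 _ _ _).2.1⟩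
  let D : List Bool → Set X := fun l => (DP l).val
  have hanti : ClosureAntitone D := by
    intro l a
    cases a
    · exact (h0 _ _ _).2.2.1
    exact (h1 _ _ _).2.2.1
  have hdiam : VanishingDiam D := by
    intro x
    apply tendsto_of_tendsto_of_tendsto_of_le_of_le' tendsto_const_nhds hu
    · simp
    rw [eventually_atTop]
    refine ⟨1, fun m (hm : 1 ≤ m) => ?_⟩
    rw [Nat.one_le_iff_ne_zero] at hm
    rcases Nat.exists_eq_succ_of_ne_zero hm with ⟨n, rfl⟩
    dsimp
    cases x n
    · convert! (h0 _ _ _).2.2.2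
      rw [PiNat.res_length]
    convert! (h1 _ _ _).2.2.2
    rw [PiNat.res_length]
  have hdisj' : CantorScheme.Disjoint fun l => g '' D l := by
    rintro l (a | a) (b | b) hab <;> try contradiction
    · exact hdisj _ _ _
    exact (hdisj _ _ _).symm
  have hne : ∀ l, (D l).Nonempty := fun l => by
    by_contra h
    exact (DP l).property.2 (by
      have : (DP l).val = ∅ := not_nonempty_iff_eq_empty.1 h
      simp [this])
  have hdom : ∀ {x : ℕ → Bool}, x ∈ (inducedMap D).1 := fun {x} => by
    rw [hanti.map_of_vanishingDiam hdiam hne]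
    apply mem_univ
  refine ⟨fun x => (inducedMap D).2 ⟨x, hdom⟩, hdiam.map_continuous.comp (by fun_prop), ?_⟩
  have hdom' : ∀ x : ℕ → Bool, x ∈ (inducedMap fun l => g '' D l).1 := fun x =>
    ⟨g ((inducedMap D).2 ⟨x, hdom⟩), mem_iInter.2 fun n => mem_image_of_mem g (map_mem ⟨x, hdom⟩ n)⟩
  intro x y hxy
  refine res_injective ?_
  ext1 n
  induction n with
  | zero => simp
  | succ n ih =>
    simp only [res_succ, List.cons.injEq]
    refine ⟨?_, ih⟩
    by_contra hne
    refine disjoint_left.1 (hdisj' (res x n) hne) (mem_image_of_mem g (map_mem ⟨x, hdom⟩ (n + 1))) ?_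
    have h := mem_image_of_mem g (map_mem (A := D) ⟨y, hdom⟩ (n + 1))
    rw [res_succ, ← ih] at h
    exact (show g _ = g _ from hxy) ▸ h

/-- A map on a standard Borel space all of whose preimages are measurable has countable range. -/
theorem countable_range_of_forall_measurableSet_preimage {X I : Type*} [MeasurableSpace X]
    [StandardBorelSpace X] {g : X → I} (hg : ∀ A : Set I, MeasurableSet (g ⁻¹' A)) :
    (range g).Countable := by
  by_contra hunc
  let up := upgradeStandardBorel X
  obtain ⟨e, -, he⟩ := MeasurableSpace.measurable_injection_nat_bool_of_countablySeparated X
  let c : X → X := fun x => rangeSplitting g ⟨g x, mem_range_self x⟩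
  have hc : ∀ x, g (c x) = g x := fun x => apply_rangeSplitting g _
  have hmeas : Measurable (e ∘ c) := fun A _ => by
    convert! hg {i | ∃ h : i ∈ range g, e (rangeSplitting g ⟨i, h⟩) ∈ A} using 1
    ext x
    simp [c]
  have hunc' : ¬ (range (e ∘ c)).Countable := fun h => hunc <| by
    rw [range_comp] at h
    refine ((countable_of_injective_of_countable_image he.injOn h).image g).mono ?_
    rintro _ ⟨x, rfl⟩
    exact ⟨c x, mem_range_self x, hc x⟩
  obtain ⟨φ, hφ, hinj⟩ : ∃ φ : (ℕ → Bool) → X, Continuous φ ∧ Function.Injective ((e ∘ c) ∘ φ) := by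
    obtain ⟨t', ht', hcont, hpol⟩ := hmeas.exists_continuous
    obtain ⟨φ, hφ, hinj⟩ := @exists_nat_bool_injective_comp X _ t' hpol _ _ _ hcont hunc'
    exact ⟨φ, continuous_le_rng ht' hφ, hinj⟩
  have hφm : Measurable φ := hφ.measurable
  have hginj : Function.Injective (g ∘ φ) := fun x y hxy => hinj <| by
    have : g (φ x) = g (φ y) := hxy
    simp only [Function.comp_apply, c, this]
  have hall : ∀ B : Set (ℕ → Bool), MeasurableSet B := fun B => by
    rw [← preimage_image_eq B hginj, preimage_comp]
    exact hφm (hg _)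
  obtain ⟨b, hbc, hb⟩ := MeasurableSpace.CountablyGenerated.isCountablyGenerated (α := ℕ → Bool)
  have hcard := MeasurableSpace.cardinal_measurableSet_le_continuum
    (Cardinal.mk_le_aleph0_iff.2 hbc.to_subtype |>.trans Cardinal.aleph0_le_continuum)
  rw [← hb] at hcard
  have huniv : {B : Set (ℕ → Bool) | MeasurableSet B} = univ := eq_univ_of_forall hall
  have h := (Cardinal.mk_congr (Equiv.setCongr huniv)).symm.trans_le hcard
  rw [Cardinal.mk_univ, Cardinal.mk_set] at h
  refine absurd h (not_le.2 ?_)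
  simpa using Cardinal.cantor Cardinal.continuum

end UncountableImage

/-- Every open cover of a metric space has a selector all of whose preimages are Borel. -/
theorem exists_selector_measurableSet_preimage {X ι : Type*} [MetricSpace X] [MeasurableSpace X]
    [BorelSpace X] (U : ι → Set X) (hU : ∀ i, IsOpen (U i)) (hcov : ∀ x, ∃ i, x ∈ U i) :
    ∃ π : X → ι, (∀ x, x ∈ U (π x)) ∧ ∀ A : Set ι, MeasurableSet (π ⁻¹' A) := by
  obtain ⟨_, hwf⟩ := exists_wellFoundedLT ι
  choose π hπU hπmin using fun x => hwf.wf.has_min {i | x ∈ U i} (hcov x)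
  refine ⟨π, hπU, fun A => ?_⟩
  set P : ℕ → ι → Set X := fun n i =>
    {x | (∀ j < i, x ∉ U j) ∧ ENNReal.ofReal (1 / (n + 1)) ≤ Metric.infEDist x (U i)ᶜ} with hP
  have hPclosed : ∀ n i, IsClosed (P n i) := by
    intro n i
    have : P n i = (⋂ j, ⋂ (_ : j < i), (U j)ᶜ) ∩
        {x | ENNReal.ofReal (1 / (n + 1)) ≤ Metric.infEDist x (U i)ᶜ} := by
      ext x; simp [hP]
    rw [this]
    refine IsClosed.inter (isClosed_iInter fun j => isClosed_iInter fun _ => (hU j).isClosed_compl) ?_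
    exact isClosed_le continuous_const Metric.continuous_infEDist
  have hpos : ∀ n : ℕ, (0 : ℝ) < 1 / (n + 1) := fun n => by positivity
  have hPmem : ∀ n i x, x ∈ P n i → π x = i := by
    intro n i x hx
    have hxi : x ∈ U i := by
      by_contra h
      have := hx.2
      rw [Metric.infEDist_zero_of_mem h] at this
      simp only [nonpos_iff_eq_zero, ENNReal.ofReal_eq_zero] at this
      exact absurd this (not_le.2 (hpos n))
    refine le_antisymm (not_lt.1 (hπmin x i hxi)) (not_lt.1 fun h => hx.1 _ h (hπU x))
  have hsep : ∀ n i j x y, x ∈ P n i → y ∈ P n j → i < j → 1 / (n + 1 : ℝ) ≤ dist x y := by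
    intro n i j x y hx hy hij
    have h1 := hx.2.trans (Metric.infEDist_le_edist_of_mem (hy.1 i hij))
    rw [edist_dist] at h1
    exact (ENNReal.ofReal_le_ofReal_iff dist_nonneg).1 h1
  have hlf : ∀ n, LocallyFinite (P n) := by
    intro n x
    refine ⟨Metric.ball x (1 / (n + 1) / 2), Metric.ball_mem_nhds x (half_pos (hpos n)), ?_⟩
    refine Set.Subsingleton.finite ?_
    rintro i ⟨y, hyi, hy⟩ j ⟨y', hyj, hy'⟩
    have hd : dist y y' < 1 / (n + 1) := by
      have := dist_triangle_right y y' x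
      rw [Metric.mem_ball] at hy hy'
      linarith
    rcases lt_trichotomy i j with h | h | h
    · exact absurd (hsep n i j y y' hyi hyj h) (not_le.2 hd)
    · exact h
    · exact absurd (hsep n j i y' y hyj hyi h) (not_le.2 (by rwa [dist_comm]))
  have hA : π ⁻¹' A = ⋃ n, ⋃ i : A, P n i := by
    ext x
    simp only [Set.mem_preimage, Set.mem_iUnion]
    constructor
    · intro hx
      have h0 : 0 < Metric.infEDist x (U (π x))ᶜ := by
        rw [pos_iff_ne_zero, Ne, ← Metric.mem_closure_iff_infEDist_zero,
          (hU _).isClosed_compl.closure_eq]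
        exact not_not.2 (hπU x)
      have : ∃ n : ℕ, ENNReal.ofReal (1 / (n + 1)) ≤ Metric.infEDist x (U (π x))ᶜ := by
        have ht : Tendsto (fun n : ℕ => ENNReal.ofReal (1 / ((n : ℝ) + 1))) atTop (𝓝 0) := by
          simpa using ENNReal.tendsto_ofReal tendsto_one_div_add_atTop_nhds_zero_nat
        exact (ht.eventually_le_const h0).exists
      obtain ⟨n, hn⟩ := this
      exact ⟨n, ⟨π x, hx⟩, fun j hj hxj => hπmin x j hxj hj, hn⟩
    · rintro ⟨n, i, hx⟩
      rw [hPmem n i x hx]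
      exact i.2
  rw [hA]
  exact MeasurableSet.iUnion fun n =>
    (((hlf n).comp_injective Subtype.val_injective).isClosed_iUnion fun i =>
      hPclosed n i.1).measurableSet

theorem Ergodic.exists_countable_ae_mem {α I J : Type*} [MeasurableSpace α] {ν : Measure α}
    [IsProbabilityMeasure ν] {f : α → α} (hf : Ergodic f ν) {π : α → I}
    (hπ : ∀ A : Set I, MeasurableSet (π ⁻¹' A)) {R : I → Set I} (hRc : ∀ i, (R i).Countable)
    (hRπ : ∀ x, π x ∈ R (π x)) (hRf : ∀ x, R (π (f x)) ⊆ R (π x))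
    [MeasurableSpace J] [MeasurableSpace.CountablySeparated J] [MeasurableEq J] [Nonempty J]
    (H : I → J) : ∃ D : Set J, D.Countable ∧ ∀ᵐ x ∂ν, H (π x) ∈ D := by
  obtain ⟨_, hwf⟩ := exists_wellFoundedLT J
  have hm : ∀ A : Set J, MeasurableSet ((fun x => H (π x)) ⁻¹' A) := fun A => hπ (H ⁻¹' A)
  set h : α → J := fun x => H (π x) with hh
  set D : Set J := {j | 0 < ν (h ⁻¹' {j})} with hD
  refine ⟨D, ?_, ?_⟩
  · refine Measure.countable_meas_pos_of_disjoint_iUnion (fun j => hm {j}) fun i j hij => ?_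
    exact Disjoint.preimage _ (Set.disjoint_singleton.2 hij)
  by_contra hcon
  have hcon' : ν (h ⁻¹' Dᶜ) ≠ 0 := hcon
  obtain ⟨A, hAD, hA, hAj⟩ : ∃ A ⊆ Dᶜ, ν (h ⁻¹' A) ≠ 0 ∧
      ∀ j ∈ A, ν (h ⁻¹' (A ∩ Set.Iio j)) = 0 := by
    by_cases hex : ∃ j, ν (h ⁻¹' (Dᶜ ∩ Set.Iio j)) ≠ 0
    · obtain ⟨θ, hθ, hmin⟩ := hwf.wf.has_min {j | ν (h ⁻¹' (Dᶜ ∩ Set.Iio j)) ≠ 0} hex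
      refine ⟨Dᶜ ∩ Set.Iio θ, Set.inter_subset_left, hθ, fun j hj => ?_⟩
      refine measure_mono_null ?_ (not_not.1 fun hne => hmin j hne hj.2)
      exact Set.preimage_mono (Set.inter_subset_inter_left _ Set.inter_subset_left)
    · push Not at hex
      exact ⟨Dᶜ, subset_rfl, hcon', fun j _ => hex j⟩
  have hAle : ∀ j ∈ A, ν (h ⁻¹' (A ∩ Set.Iic j)) = 0 := by
    intro j hj
    refine measure_mono_null (t := h ⁻¹' (A ∩ Set.Iio j) ∪ h ⁻¹' {j}) ?_
      (measure_union_null (hAj j hj) (not_not.1 fun hne => hAD hj (pos_iff_ne_zero.2 hne)))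
    rintro x ⟨hxA, hx⟩
    rcases lt_or_eq_of_le hx with hx | hx
    · exact Or.inl ⟨hxA, hx⟩
    · exact Or.inr hx
  have hcof : ∀ C ⊆ A, C.Countable → ∃ j ∈ A, ∀ c ∈ C, c < j := by
    intro C hCA hC
    by_contra! hno
    refine hA (measure_mono_null (t := ⋃ c ∈ C, h ⁻¹' (A ∩ Set.Iic c)) ?_
      ((measure_biUnion_null_iff hC).2 fun c hc => hAle c (hCA hc)))
    intro x hx
    obtain ⟨c, hc, hxc⟩ := hno _ hx
    exact Set.mem_biUnion hc ⟨hx, hxc⟩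
  choose s hsA hsmin using fun i => hwf.wf.has_min {j | j ∈ A ∧ ∀ c ∈ H '' R i ∩ A, c < j} <| by
    obtain ⟨j, hj, hc⟩ := hcof (H '' R i ∩ A) Set.inter_subset_right
      (((hRc i).image H).mono Set.inter_subset_left)
    exact ⟨j, hj, hc⟩
  set t : α → J := fun x => s (π x) with ht
  have htm : Measurable t := fun B _ => hπ (s ⁻¹' B)
  have htf : ∀ x, t (f x) ≤ t x := fun x => not_lt.1 <| hsmin (π (f x)) _
    ⟨(hsA (π x)).1, fun c hc => (hsA (π x)).2 c ⟨Set.image_mono (hRf x) hc.1, hc.2⟩⟩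
  have hrec := hf.toMeasurePreserving.conservative.ae_mem_imp_frequently_image_mem
    (measurableSet_eq_fun (htm.comp hf.measurable) htm).compl.nullMeasurableSet
  have hinv : t ∘ f =ᵐ[ν] t := by
    filter_upwards [hrec] with x hx
    by_contra hne
    have hfr := hx hne
    obtain ⟨_, ⟨N, rfl⟩, hN⟩ := hwf.wf.has_min (Set.range fun n => t (f^[n] x)) (Set.range_nonempty _)
    have hanti : Antitone fun n => t (f^[n] x) := antitone_nat_of_succ_le fun n => by
      rw [Function.iterate_succ_apply']
      exact htf _
    obtain ⟨n, hn, hnB⟩ := (frequently_atTop.1 hfr) N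
    refine hN _ ⟨n + 1, rfl⟩ (lt_of_lt_of_le ?_ (hanti hn))
    simp only [Function.iterate_succ_apply']
    exact lt_of_le_of_ne (htf _) hnB
  obtain ⟨t₀, ht₀⟩ := hf.ae_eq_const_of_ae_eq_comp₀ htm.nullMeasurable hinv
  have hlt : ∀ x, h x ∈ A → h x < t x := fun x hx =>
    (hsA (π x)).2 _ ⟨⟨π x, hRπ x, rfl⟩, hx⟩
  have ht₀A : t₀ ∈ A := by
    obtain ⟨x, hx⟩ := ht₀.exists
    rw [Function.const_apply] at hx
    exact hx ▸ (hsA (π x)).1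
  refine hA ?_
  have : (h ⁻¹' A : Set α) ≤ᵐ[ν] (h ⁻¹' (A ∩ Set.Iio t₀) : Set α) := by
    filter_upwards [ht₀] with x hx hxA
    refine ⟨hxA, ?_⟩
    have := hlt x hxA
    rwa [hx] at this
  exact le_antisymm ((measure_mono_ae this).trans (hAj t₀ ht₀A).le) bot_le

theorem UniformContinuous.exists_countable_approx {M Z : Type*} [MetricSpace M]
    [LocallyCompactSpace M] [MeasurableSpace M] [BorelSpace M] {ν : Measure M}
    [IsProbabilityMeasure ν] {f : M → M} (hf : Ergodic f ν) [UniformSpace Z] [Countable Z]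
    {Φ : M × Z → ℝ} (hΦ : UniformContinuous Φ) {ε : ℝ} (hε : 0 < ε) :
    ∃ h : M → Z → ℝ, (∀ A, MeasurableSet (h ⁻¹' A)) ∧ (∀ y z, |Φ (y, z) - h y z| ≤ ε) ∧
      ∃ D : Set (Z → ℝ), D.Countable ∧ ∀ᵐ y ∂ν, h y ∈ D := by
  have hunif : ∃ δ > 0, ∀ y m : M, dist y m < δ → ∀ z, |Φ (y, z) - Φ (m, z)| ≤ ε := by
    have h1 := hΦ (Metric.dist_mem_uniformity hε)
    rw [mem_map, uniformity_prod_eq_comap_prod, mem_comap] at h1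
    obtain ⟨s, hs, hsub⟩ := h1
    obtain ⟨a, ha, b, hb, hab⟩ := mem_prod_iff.1 hs
    obtain ⟨δ, hδ, hδa⟩ := Metric.mem_uniformity_dist.1 ha
    refine ⟨δ, hδ, fun y m hym z => ?_⟩
    have : ((y, z), (m, z)) ∈ (fun x : (M × Z) × M × Z => (Φ x.1, Φ x.2)) ⁻¹'
        {q : ℝ × ℝ | dist q.1 q.2 < ε} :=
      hsub (hab ⟨hδa hym, refl_mem_uniformity hb⟩)
    exact le_of_lt this
  obtain ⟨δ, hδ, hΦδ⟩ := hunif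
  choose K hK hKm using fun m : M => exists_compact_mem_nhds m
  set U : M → Set M := fun m => interior (K m) ∩ Metric.ball m δ with hU
  obtain ⟨π, hπU, hπ⟩ := exists_selector_measurableSet_preimage U
    (fun m => isOpen_interior.inter Metric.isOpen_ball)
    (fun m => ⟨m, mem_interior_iff_mem_nhds.2 (hKm m), Metric.mem_ball_self hδ⟩)
  set Γ : M → Set M := fun m => Set.range fun x : K m => π (f x) with hΓ
  have hΓc : ∀ m, (Γ m).Countable := fun m => by
    have := isCompact_iff_compactSpace.1 (hK m)
    exact countable_range_of_forall_measurableSet_preimage fun A =>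
      measurable_subtype_coe (hf.measurable (hπ A))
  have hΓf : ∀ y, π (f y) ∈ Γ (π y) := fun y => ⟨⟨y, interior_subset (hπU y).1⟩, rfl⟩
  set E : Set M → Set M := fun S => ⋃ m ∈ S, Γ m with hE
  have hEmono : Monotone E := fun S T hST => Set.biUnion_subset_biUnion_left hST
  obtain ⟨D, hD, hDae⟩ := hf.exists_countable_ae_mem hπ (R := fun m => ⋃ n, E^[n] {m})
    (fun m => Set.countable_iUnion fun n => by
      induction n with
      | zero => exact Set.countable_singleton m
      | succ n ih =>
        rw [Function.iterate_succ_apply']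
        exact ih.biUnion fun _ _ => hΓc _)
    (fun y => Set.mem_iUnion.2 ⟨0, rfl⟩)
    (fun y => Set.iUnion_subset fun n => by
      refine subset_trans ?_ (Set.subset_iUnion _ (n + 1))
      rw [Function.iterate_succ_apply]
      refine hEmono.iterate n (Set.singleton_subset_iff.2 ?_)
      exact Set.mem_biUnion (Set.mem_singleton _) (hΓf y))
    (fun (m : M) (z : Z) => Φ (m, z))
  exact ⟨fun y z => Φ (π y, z), fun A => hπ ((fun (m : M) (z : Z) => Φ (m, z)) ⁻¹' A),
    fun y z => hΦδ y _ (hπU y).2 z, D, hD, hDae⟩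

theorem measurable_floor_mul {d : ℕ} (L : ℝ) :
    Measurable fun (ζ : Fin d → ℝ) (i : Fin d) => ⌊ζ i * L⌋ := by
  fun_prop

theorem map_floor_mul_volume {d : ℕ} {L : ℝ} (hL : 0 < L) :
    Measure.map (fun (ζ : Fin d → ℝ) (i : Fin d) => ⌊ζ i * L⌋) volume =
      ENNReal.ofReal ((L ^ d)⁻¹) • Measure.count := by
  refine Measure.ext_of_singleton fun w => ?_
  rw [Measure.map_apply (measurable_floor_mul L) (measurableSet_singleton w)]
  have : (fun (ζ : Fin d → ℝ) (i : Fin d) => ⌊ζ i * L⌋) ⁻¹' {w} =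
      Set.pi Set.univ fun i => Set.Ico ((w i : ℝ) / L) ((w i + 1) / L) := by
    ext ζ
    simp only [Set.mem_preimage, Set.mem_singleton_iff, funext_iff, Set.mem_pi, Set.mem_univ,
      forall_const, Set.mem_Ico, Int.floor_eq_iff, div_le_iff₀ hL, lt_div_iff₀ hL]
  rw [this, Real.volume_pi_Ico]
  have h : ∀ i, ((w i : ℝ) + 1) / L - w i / L = L⁻¹ := fun i => by ring
  simp only [h, Finset.prod_const, Finset.card_univ, Fintype.card_fin, Measure.smul_apply,
    Measure.count_singleton, smul_eq_mul, mul_one]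
  rw [← ENNReal.ofReal_pow (by positivity), inv_pow]

theorem integral_comp_floor_mul {d : ℕ} {L : ℝ} (hL : 0 < L) (F : (Fin d → ℤ) → ℝ) :
    ∫ ζ : Fin d → ℝ, F (fun i => ⌊ζ i * L⌋) = (L ^ d)⁻¹ * ∫ w, F w ∂Measure.count := by
  rw [← integral_map (φ := fun (ζ : Fin d → ℝ) (i : Fin d) => ⌊ζ i * L⌋) (f := F)
    (measurable_floor_mul L).aemeasurable (measurable_of_countable F).aestronglyMeasurable,
    map_floor_mul_volume hL, integral_smul_measure, ENNReal.toReal_ofReal (by positivity),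
    smul_eq_mul]

theorem integrable_comp_floor_mul {d : ℕ} {L : ℝ} (hL : 0 < L) {F : (Fin d → ℤ) → ℝ}
    (hF : Integrable F Measure.count) :
    Integrable fun ζ : Fin d → ℝ => F (fun i => ⌊ζ i * L⌋) := by
  refine Integrable.comp_measurable (g := F) (f := fun (ζ : Fin d → ℝ) (i : Fin d) => ⌊ζ i * L⌋)
    ?_ (measurable_floor_mul L)
  rw [map_floor_mul_volume hL]
  exact hF.smul_measure ENNReal.ofReal_ne_top

theorem integral_count_ite_eq {W : Type*} [MeasurableSpace W] [MeasurableSingletonClass W]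
    [DecidableEq W] (w : W) (c : ℝ) :
    Integrable (fun v => if w = v then c else 0) Measure.count ∧
      ∫ v, (if w = v then c else 0) ∂Measure.count = c := by
  have h : (fun v => if w = v then c else 0) = Set.indicator {w} fun _ => c := by
    ext v
    by_cases h : w = v <;> simp [Set.indicator, h, eq_comm]
  rw [h, integrable_indicator_iff (measurableSet_singleton w),
    integral_indicator_const _ (measurableSet_singleton w)]
  exact ⟨integrableOn_const (C := c) (by simp), by simp [Measure.real]⟩

section LocalDensity

variable {d : ℕ} {M : Type*} [MeasurableSpace M]

/-- The density on `ℝ^d`, at scale `L`, of the image under `σ` of the signed measure `g ν`. -/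
noncomputable def localDensity (ν : Measure M) (σ : M → Fin d → ℤ) (L : ℝ) (g : M → ℝ)
    (ζ : Fin d → ℝ) : ℝ :=
  L ^ d * ∫ y, (if σ y = fun i => ⌊ζ i * L⌋ then g y else 0) ∂ν

variable {ν : Measure M} {σ : M → Fin d → ℤ} {L : ℝ} {g : M → ℝ}

theorem integrable_localDensity_kernel (hσ : Measurable σ) (hL : 0 < L) (hg : Measurable g)
    (hgi : Integrable g ν) :
    Integrable (fun x : M × (Fin d → ℝ) => if σ x.1 = fun i => ⌊x.2 i * L⌋ then g x.1 else 0)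
      (ν.prod volume) := by
  have hfl : Measurable fun x : M × (Fin d → ℝ) => fun i => ⌊x.2 i * L⌋ :=
    (measurable_floor_mul L).comp measurable_snd
  have hms : MeasurableSet {x : M × (Fin d → ℝ) | σ x.1 = fun i => ⌊x.2 i * L⌋} :=
    measurableSet_eq_fun (hσ.comp measurable_fst) hfl
  have hm : Measurable fun x : M × (Fin d → ℝ) =>
      if σ x.1 = fun i => ⌊x.2 i * L⌋ then g x.1 else 0 :=
    Measurable.ite hms (hg.comp measurable_fst) measurable_const
  refine (integrable_prod_iff hm.aestronglyMeasurable).2 ⟨ae_of_all _ fun y => ?_, ?_⟩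
  · exact integrable_comp_floor_mul hL (integral_count_ite_eq (σ y) (g y)).1
  · have : ∀ y, ∫ ζ : Fin d → ℝ, ‖if σ y = fun i => ⌊ζ i * L⌋ then g y else 0‖ =
        (L ^ d)⁻¹ * ‖g y‖ := by
      intro y
      rw [integral_comp_floor_mul hL fun v => ‖if σ y = v then g y else 0‖]
      simp only [apply_ite norm, norm_zero, (integral_count_ite_eq (σ y) ‖g y‖).2]
    simp only [this]
    exact hgi.norm.const_mul _

theorem integrable_localDensity [SFinite ν] (hσ : Measurable σ) (hL : 0 < L) (hg : Measurable g)
    (hgi : Integrable g ν) : Integrable (localDensity ν σ L g) :=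
  (integrable_localDensity_kernel hσ hL hg hgi).integral_prod_right.const_mul _

theorem integral_mul_localDensity [SFinite ν] (hσ : Measurable σ) (hL : 0 < L) (hg : Measurable g)
    (hgi : Integrable g ν) {s : (Fin d → ℤ) → ℝ} {C : ℝ} (hs : ∀ w, |s w| ≤ C) :
    ∫ ζ : Fin d → ℝ, s (fun i => ⌊ζ i * L⌋) * localDensity ν σ L g ζ =
      ∫ y, g y * s (σ y) ∂ν := by
  have hker := integrable_localDensity_kernel (ν := ν) hσ hL hg hgi
  have hsm : Measurable fun x : M × (Fin d → ℝ) => s (fun i => ⌊x.2 i * L⌋) :=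
    (measurable_of_countable s).comp ((measurable_floor_mul L).comp measurable_snd)
  have hker' : Integrable (fun x : M × (Fin d → ℝ) => s (fun i => ⌊x.2 i * L⌋) *
      if σ x.1 = fun i => ⌊x.2 i * L⌋ then g x.1 else 0) (ν.prod volume) :=
    hker.bdd_mul hsm.aestronglyMeasurable (ae_of_all _ fun x => hs _)
  have hswap := integral_integral_swap (f := fun (y : M) (ζ : Fin d → ℝ) =>
    s (fun i => ⌊ζ i * L⌋) * if σ y = fun i => ⌊ζ i * L⌋ then g y else 0) hker'
  have hinner : ∀ y, ∫ ζ : Fin d → ℝ, s (fun i => ⌊ζ i * L⌋) *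
      (if σ y = fun i => ⌊ζ i * L⌋ then g y else 0) = (L ^ d)⁻¹ * (g y * s (σ y)) := by
    intro y
    rw [integral_comp_floor_mul hL fun v => s v * if σ y = v then g y else 0]
    have : (fun v => s v * if σ y = v then g y else 0) =
        fun v => if σ y = v then g y * s (σ y) else 0 := by
      ext v
      split_ifs with h
      · rw [h, mul_comm]
      · simp
    rw [this, (integral_count_ite_eq (σ y) _).2]
  simp only [hinner, integral_const_mul] at hswap
  simp only [localDensity, mul_left_comm _ (L ^ d), integral_const_mul]
  rw [← hswap, mul_inv_cancel_left₀ (by positivity)]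

end LocalDensity

/-- A generalized Scheffé lemma. -/
theorem tendsto_integral_abs_sub_of_dominated_density {E : Type*} [MeasurableSpace E]
    {m : Measure E} {q a : ℕ → E → ℝ} {p : E → ℝ} {c C : ℝ} (hp : Integrable p m)
    (hp0 : ∀ x, 0 ≤ p x) (hq : ∀ᶠ n in atTop, Integrable (q n) m ∧ ∫ x, q n x ∂m = ∫ x, p x ∂m)
    (ha : ∀ᶠ n in atTop, Integrable (a n) m) (hC : 0 ≤ C)
    (haq : ∀ᶠ n in atTop, ∀ x, |a n x| ≤ C * q n x)
    (hq_lim : ∀ x, Tendsto (fun n => q n x) atTop (𝓝 (p x)))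
    (ha_lim : ∀ x, Tendsto (fun n => a n x) atTop (𝓝 (c * p x))) :
    Tendsto (fun n => ∫ x, |a n x - c * p x| ∂m) atTop (𝓝 0) := by
  set G : ℕ → E → ℝ := fun n x =>
    min |a n x - c * p x| ((C + |c|) * p x) + C * max (p x - q n x) 0 with hG
  have hGm : ∀ᶠ n in atTop, AEStronglyMeasurable (G n) m := by
    filter_upwards [hq, ha] with n hqn han
    have h1 := ((han.sub (hp.const_mul c)).abs.inf (hp.const_mul (C + |c|)))
    have h2 := ((hp.sub hqn.1).sup (integrable_zero E ℝ m)).const_mul C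
    exact (h1.add h2).aestronglyMeasurable
  have hq0 : ∀ᶠ n in atTop, ∀ x, 0 ≤ C * q n x := by
    filter_upwards [haq] with n hn x using (abs_nonneg _).trans (hn x)
  have hGb : ∀ᶠ n in atTop, ∀ᵐ x ∂m, ‖G n x‖ ≤ (2 * C + |c|) * p x := by
    filter_upwards [hq0] with n hn
    refine ae_of_all _ fun x => ?_
    have h1 : C * max (p x - q n x) 0 ≤ C * p x := by
      rw [mul_max_of_nonneg _ _ hC, mul_zero]
      exact max_le (by nlinarith [hn x]) (mul_nonneg hC (hp0 x))
    have h2 : 0 ≤ (C + |c|) * p x := mul_nonneg (by positivity) (hp0 x)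
    rw [Real.norm_of_nonneg]
    · have := min_le_right |a n x - c * p x| ((C + |c|) * p x)
      simp only [hG]
      linarith
    · exact add_nonneg (le_min (abs_nonneg _) h2) (mul_nonneg hC (le_max_right _ _))
  have hGlim : ∀ᵐ x ∂m, Tendsto (fun n => G n x) atTop (𝓝 0) := by
    refine ae_of_all _ fun x => ?_
    have h1 : Tendsto (fun n => |a n x - c * p x|) atTop (𝓝 0) := by
      simpa using ((ha_lim x).sub_const (c * p x)).abs
    have h2 : Tendsto (fun n => max (p x - q n x) 0) atTop (𝓝 0) := by
      simpa using ((hq_lim x).const_sub (p x)).max (tendsto_const_nhds (x := (0 : ℝ)))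
    have h3 : 0 ≤ (C + |c|) * p x := mul_nonneg (by positivity) (hp0 x)
    simpa [h3] using (h1.min (tendsto_const_nhds (x := (C + |c|) * p x))).add (h2.const_mul C)
  have hlim := tendsto_integral_filter_of_dominated_convergence (fun x => (2 * C + |c|) * p x)
    hGm hGb (hp.const_mul _) hGlim
  rw [integral_zero] at hlim
  refine squeeze_zero' (.of_forall fun n => integral_nonneg fun x => abs_nonneg _) ?_ hlim
  filter_upwards [hq, ha, haq] with n hqn han hn
  have hI1 : Integrable (fun x => min |a n x - c * p x| ((C + |c|) * p x)) m :=
    ((han.sub (hp.const_mul c)).abs.inf (hp.const_mul (C + |c|)))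
  have hI2 : Integrable (fun x => C * max (p x - q n x) 0) m :=
    ((hp.sub hqn.1).sup (integrable_zero E ℝ m)).const_mul C
  have hI3 : Integrable (fun x => C * (q n x - p x)) m := (hqn.1.sub hp).const_mul C
  have h3 : ∫ x, C * (q n x - p x) ∂m = 0 := by
    rw [integral_const_mul, integral_sub hqn.1 hp, hqn.2, sub_self, mul_zero]
  calc ∫ x, |a n x - c * p x| ∂m
      ≤ ∫ x, (G n x + C * (q n x - p x)) ∂m := by
        refine integral_mono (han.sub (hp.const_mul c)).abs ((hI1.add hI2).add hI3) fun x => ?_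
        have hb : |a n x - c * p x| ≤ C * q n x + |c| * p x := by
          refine (abs_sub _ _).trans (add_le_add (hn x) ?_)
          rw [abs_mul, abs_of_nonneg (hp0 x)]
        have hpos : 0 ≤ C * (max (p x - q n x) 0 + (q n x - p x)) :=
          mul_nonneg hC (by linarith [le_max_left (p x - q n x) 0])
        have hpos' : C * (q n x - p x) ≤ C * (max (p x - q n x) 0 + (q n x - p x)) :=
          mul_le_mul_of_nonneg_left (by linarith [le_max_right (p x - q n x) 0]) hC
        simp only [hG]
        rcases min_choice |a n x - c * p x| ((C + |c|) * p x) with h | h <;> rw [h] <;> linarith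
    _ = ∫ x, G n x ∂m := by
        rw [integral_add (f := G n) (hI1.add hI2) hI3, h3, add_zero]

theorem tendsto_integral_mul_of_approx {E : Type*} [MeasurableSpace E] {m : Measure E}
    {v : ℕ → E → ℝ} (hv : ∀ n, Measurable (v n)) {C : ℝ} (hC : ∀ n x, |v n x| ≤ C) {c : ℝ}
    {φ : E → ℝ} (hφ : Integrable φ m)
    (happ : ∀ ε > 0, ∃ g : E → ℝ, Integrable g m ∧ ∫ x, |φ x - g x| ∂m ≤ ε ∧
      Tendsto (fun n => ∫ x, g x * v n x ∂m) atTop (𝓝 (c * ∫ x, g x ∂m))) :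
    Tendsto (fun n => ∫ x, φ x * v n x ∂m) atTop (𝓝 (c * ∫ x, φ x ∂m)) := by
  rw [Metric.tendsto_atTop]
  intro ε hε
  obtain ⟨g, hg, hgφ, hglim⟩ := happ (ε / 2 / (|C| + |c| + 1)) (by positivity)
  obtain ⟨N, hN⟩ := (Metric.tendsto_atTop.1 hglim) (ε / 2) (by positivity)
  refine ⟨N, fun n hn => ?_⟩
  have hmul : ∀ {ψ : E → ℝ}, Integrable ψ m → Integrable (fun x => ψ x * v n x) m := fun hψ =>
    hψ.mul_bdd (hv n).aestronglyMeasurable (ae_of_all _ fun x => hC n x)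
  have hsub := hφ.sub hg
  have h1 : |∫ x, φ x * v n x ∂m - ∫ x, g x * v n x ∂m| ≤ |C| * ∫ x, |φ x - g x| ∂m := by
    rw [← integral_sub (hmul hφ) (hmul hg), ← integral_const_mul]
    refine (abs_integral_le_integral_abs).trans
      (integral_mono ((hmul hφ).sub (hmul hg)).abs (hsub.abs.const_mul _) fun x => ?_)
    simp only [← sub_mul, abs_mul]
    rw [mul_comm]
    exact mul_le_mul_of_nonneg_right ((hC n x).trans (le_abs_self C)) (abs_nonneg _)
  have h2 : |c * ∫ x, g x ∂m - c * ∫ x, φ x ∂m| ≤ |c| * ∫ x, |φ x - g x| ∂m := by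
    rw [← mul_sub, abs_mul, abs_sub_comm, ← integral_sub hφ hg]
    exact mul_le_mul_of_nonneg_left abs_integral_le_integral_abs (abs_nonneg _)
  have h3 := hN n hn
  rw [Real.dist_eq] at h3 ⊢
  have h4 : (|C| + |c|) * ∫ x, |φ x - g x| ∂m ≤ ε / 2 := by
    have h0 : 0 ≤ ∫ x, |φ x - g x| ∂m := integral_nonneg fun x => abs_nonneg _
    calc (|C| + |c|) * ∫ x, |φ x - g x| ∂m
        ≤ (|C| + |c| + 1) * (ε / 2 / (|C| + |c| + 1)) := 
          mul_le_mul (by linarith) hgφ h0 (by positivity)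
      _ = ε / 2 := by field_simp
  calc |∫ x, φ x * v n x ∂m - c * ∫ x, φ x ∂m|
      = |(∫ x, φ x * v n x ∂m - ∫ x, g x * v n x ∂m) +
          (∫ x, g x * v n x ∂m - c * ∫ x, g x ∂m) + (c * ∫ x, g x ∂m - c * ∫ x, φ x ∂m)| := by
        ring_nf
    _ ≤ |∫ x, φ x * v n x ∂m - ∫ x, g x * v n x ∂m| +
          |∫ x, g x * v n x ∂m - c * ∫ x, g x ∂m| +
          |c * ∫ x, g x ∂m - c * ∫ x, φ x ∂m| := abs_add_three _ _ _
    _ < ε := by linarith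

section WeakConvergence

variable {ι : Type*} [Fintype ι] {v : ℕ → (ι → ℝ) → ℝ} {C : ℝ}

theorem tendsto_setIntegral_inter_Icc (hv : ∀ n, Measurable (v n)) (hC : ∀ n x, |v n x| ≤ C)
    (hbox : ∀ a b : ι → ℝ, (∀ i, a i < b i) →
      Tendsto (fun n => ∫ x in Set.Icc a b, v n x) atTop (𝓝 0))
    {s : Set (ι → ℝ)} (hs : MeasurableSet s) (a b : ι → ℝ) (hab : ∀ i, a i < b i) :
    Tendsto (fun n => ∫ x in s ∩ Set.Icc a b, v n x) atTop (𝓝 0) := by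
  have hint : ∀ n (t : Set (ι → ℝ)), IntegrableOn (v n) (t ∩ Set.Icc a b) := fun n t => by
    refine Measure.integrableOn_of_bounded (M := C) ?_ (hv n).aestronglyMeasurable
      (ae_of_all _ fun x => hC n x)
    exact measure_ne_top_of_subset Set.inter_subset_right isCompact_Icc.measure_ne_top
  induction s, hs using MeasurableSpace.induction_on_inter
    (s := Set.univ.pi '' Set.univ.pi fun _ : ι => Set.range (Set.Iic : ℝ → Set ℝ)) with
  | h_eq =>
    refine (generateFrom_eq_pi (fun _ => ?_) fun _ => ?_).symm
    · rw [← borel_eq_generateFrom_Iic ℝ, ← BorelSpace.measurable_eq]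
    · exact ⟨fun n : ℕ => Set.Iic (n : ℝ), fun n => ⟨n, rfl⟩,
        Set.eq_univ_of_forall fun x => Set.mem_iUnion.2 (exists_nat_ge x)⟩
  | h_inter => exact IsPiSystem.pi fun _ => isPiSystem_Iic
  | empty => simp
  | basic t ht =>
    obtain ⟨S, hS, rfl⟩ := ht
    choose c hc using fun i => hS i (Set.mem_univ i)
    have hset : Set.univ.pi S ∩ Set.Icc a b = Set.Icc a fun i => min (c i) (b i) := by
      ext x
      simp only [← hc, Set.mem_inter_iff, Set.mem_pi, Set.mem_univ, forall_const, Set.mem_Iic,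
        Set.mem_Icc, Pi.le_def, le_min_iff, forall_and]
      tauto
    rw [hset]
    by_cases h : ∀ i, a i < min (c i) (b i)
    · exact hbox _ _ h
    · push Not at h
      obtain ⟨i, hi⟩ := h
      have hzero : volume (Set.Icc a fun i => min (c i) (b i)) = 0 := by
        rw [Real.volume_Icc_pi]
        exact Finset.prod_eq_zero (Finset.mem_univ i) (ENNReal.ofReal_eq_zero.2 (sub_nonpos.2 hi))
      simp [Measure.restrict_eq_zero.2 hzero]
  | compl t htm ih =>
    have h := (hbox a b hab).sub ih
    rw [sub_zero] at h
    refine h.congr fun n => ?_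
    have hun := hint n Set.univ
    rw [Set.univ_inter] at hun
    have := integral_inter_add_sdiff (μ := volume) htm hun
    rw [Set.inter_comm, Set.sdiff_eq, Set.inter_comm (Set.Icc a b) tᶜ] at this
    linarith
  | iUnion F hF hFm ih =>
    have hB : volume (Set.Icc a b) ≠ ⊤ := isCompact_Icc.measure_ne_top
    have hFm' : ∀ i, MeasurableSet (F i ∩ Set.Icc a b) := fun i => (hFm i).inter measurableSet_Icc
    have hF' : Pairwise (Function.onFun Disjoint fun i => F i ∩ Set.Icc a b) := fun i j hij =>
      (hF hij).mono Set.inter_subset_left Set.inter_subset_left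
    have hsum : Summable fun i => C * volume.real (F i ∩ Set.Icc a b) := by
      refine Summable.mul_left _ (ENNReal.summable_toReal ?_)
      rw [← measure_iUnion hF' hFm']
      exact measure_ne_top_of_subset (Set.iUnion_subset fun i => Set.inter_subset_right) hB
    have key := tendsto_tsum_of_dominated_convergence hsum ih (.of_forall fun n i =>
      norm_setIntegral_le_of_norm_le_const
        (measure_ne_top_of_subset Set.inter_subset_right hB).lt_top fun x _ => hC n x)
    rw [tsum_zero] at key
    refine key.congr fun n => ?_
    have hn := hint n (⋃ i, F i)
    rw [Set.iUnion_inter] at hn ⊢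
    exact (hasSum_integral_iUnion hFm' hF' hn).tsum_eq

theorem tendsto_setIntegral_of_tendsto_Icc (hv : ∀ n, Measurable (v n))
    (hC : ∀ n x, |v n x| ≤ C)
    (hbox : ∀ a b : ι → ℝ, (∀ i, a i < b i) →
      Tendsto (fun n => ∫ x in Set.Icc a b, v n x) atTop (𝓝 0))
    {s : Set (ι → ℝ)} (hs : MeasurableSet s) (hsf : volume s ≠ ⊤) :
    Tendsto (fun n => ∫ x in s, v n x) atTop (𝓝 0) := by
  have hsi : Integrable (s.indicator (1 : (ι → ℝ) → ℝ)) :=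
    (integrable_indicator_iff hs).2 (integrableOn_const (C := (1 : ℝ)) hsf)
  have hind : ∀ {t : Set (ι → ℝ)}, MeasurableSet t → ∀ n,
      ∫ x, t.indicator (1 : (ι → ℝ) → ℝ) x * v n x = ∫ x in t, v n x := fun ht n => by
    rw [← integral_indicator ht]
    refine integral_congr_ae (ae_of_all _ fun x => ?_)
    simp only [Set.indicator]
    split_ifs <;> simp
  have key := tendsto_integral_mul_of_approx hv hC (c := 0) hsi fun ε hε => by
    set B : ℕ → Set (ι → ℝ) := fun k => Set.Icc (fun _ => -(k + 1 : ℝ)) fun _ => (k + 1 : ℝ) with hB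
    have hBm : ∀ k, MeasurableSet (s ∩ B k) := fun k => hs.inter measurableSet_Icc
    have hlim : Tendsto (fun k => ∫ x, |s.indicator (1 : (ι → ℝ) → ℝ) x -
        (s ∩ B k).indicator (1 : (ι → ℝ) → ℝ) x|) atTop (𝓝 0) := by
      rw [← integral_zero (ι → ℝ) ℝ]
      refine tendsto_integral_of_dominated_convergence (s.indicator (1 : (ι → ℝ) → ℝ))
        (fun k => ?_) hsi (fun k => ae_of_all _ fun x => ?_) (ae_of_all _ fun x => ?_)
      · exact (((measurable_one.indicator hs).sub
          (measurable_one.indicator (hBm _))).abs).aestronglyMeasurable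
      · by_cases h1 : x ∈ s <;> by_cases h2 : x ∈ B k <;> simp [h1, h2]
      · refine tendsto_const_nhds.congr' ?_
        obtain ⟨k₀, hk₀⟩ := exists_nat_ge ‖x‖
        filter_upwards [eventually_ge_atTop k₀] with k hk
        have hxB : x ∈ B k := by
          have hk' : (k₀ : ℝ) ≤ k := by exact_mod_cast hk
          have : ∀ i, |x i| ≤ k + 1 := fun i => (norm_le_pi_norm x i).trans (by linarith)
          exact ⟨fun i => (abs_le.1 (this i)).1, fun i => (abs_le.1 (this i)).2⟩
        by_cases h1 : x ∈ s <;> simp [h1, hxB]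
    obtain ⟨k, hk⟩ := (hlim.eventually_le_const hε).exists
    refine ⟨(s ∩ B k).indicator 1, hsi.mono
      (measurable_one.indicator (hBm _)).aestronglyMeasurable
      (ae_of_all _ fun x => ?_), hk, ?_⟩
    · by_cases h1 : x ∈ s <;> by_cases h2 : x ∈ B k <;> simp [h1, h2]
    · simp only [hind (hBm _), zero_mul]
      exact tendsto_setIntegral_inter_Icc hv hC hbox hs _ _ fun i => by
        have : (0 : ℝ) ≤ k := k.cast_nonneg
        show -(k + 1 : ℝ) < k + 1
        linarith
  simpa only [hind hs, zero_mul] using key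

theorem tendsto_integral_mul_of_tendsto_Icc (hv : ∀ n, Measurable (v n))
    (hC : ∀ n x, |v n x| ≤ C)
    (hbox : ∀ a b : ι → ℝ, (∀ i, a i < b i) →
      Tendsto (fun n => ∫ x in Set.Icc a b, v n x) atTop (𝓝 0))
    {g : (ι → ℝ) → ℝ} (hg : Integrable g) :
    Tendsto (fun n => ∫ x, g x * v n x) atTop (𝓝 0) := by
  have hmul : ∀ {ψ : (ι → ℝ) → ℝ}, Integrable ψ → ∀ n, Integrable fun x => ψ x * v n x :=
    fun hψ n => hψ.mul_bdd (hv n).aestronglyMeasurable (ae_of_all _ fun x => hC n x)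
  refine Integrable.induction (fun g => Tendsto (fun n => ∫ x, g x * v n x) atTop (𝓝 0))
    ?_ ?_ ?_ ?_ hg
  · intro c s hs hsf
    have := (tendsto_setIntegral_of_tendsto_Icc hv hC hbox hs hsf.ne).const_mul c
    rw [mul_zero] at this
    refine this.congr fun n => ?_
    rw [← integral_const_mul, ← integral_indicator hs]
    refine integral_congr_ae (ae_of_all _ fun x => ?_)
    simp only [Set.indicator]
    split_ifs <;> simp
  · intro f g _ hf hg ihf ihg
    have := ihf.add ihg
    rw [add_zero] at this
    refine this.congr fun n => ?_
    rw [← integral_add (hmul hf n) (hmul hg n)]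
    simp only [Pi.add_apply, add_mul]
  · refine isClosed_of_closure_subset fun f hf => ?_
    have := tendsto_integral_mul_of_approx hv hC (c := 0) (L1.integrable_coeFn f) fun ε hε => by
      obtain ⟨g, hg, hfg⟩ := Metric.mem_closure_iff.1 hf ε hε
      refine ⟨g, L1.integrable_coeFn g, ?_, by
        simpa only [zero_mul, Set.mem_ofPred_eq] using hg⟩
      rw [L1.dist_eq_integral_dist] at hfg
      exact hfg.le
    simpa only [zero_mul, Set.mem_ofPred_eq] using this
  · intro f g hfg _ ih
    refine ih.congr fun n => integral_congr_ae ?_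
    filter_upwards [hfg] with x hx
    rw [hx]

end WeakConvergence

section LocalLimit

variable {d : ℕ} {M : Type*}

theorem measurable_tauSum [MeasurableSpace M] {f : M → M} (hf : Measurable f)
    {τ : M → Fin d → ℤ} (hτ : Measurable τ) (n : ℕ) : Measurable (tauSum f τ n) := by
  have : tauSum f τ n = fun y => ∑ j ∈ Finset.range n, τ (f^[j] y) := rfl
  rw [this]
  exact Finset.measurable_fun_sum _ fun j _ => hτ.comp (hf.iterate j)

theorem skewT_iterate (f : M → M) (τ : M → Fin d → ℤ) (n : ℕ) (y : M) (z : Fin d → ℤ) :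
    (skewT f τ)^[n] (y, z) = (f^[n] y, z + tauSum f τ n y) := by
  induction n with
  | zero => simp [tauSum]
  | succ n ih =>
    rw [Function.iterate_succ_apply', ih]
    simp [skewT, tauSum, Finset.sum_range_succ, Function.iterate_succ_apply', add_assoc]

variable [MeasurableSpace M] [TopologicalSpace M] {ν : Measure M} {f : M → M}
  {τ : M → Fin d → ℤ} {L : ℕ → ℝ} {p : (Fin d → ℝ) → ℝ}

theorem MLLT.integrable_density (h : MLLT ν f τ L p) : Integrable p := by
  obtain ⟨-, -, -, hp1, -⟩ := h
  by_contra hp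
  rw [integral_undef hp] at hp1
  exact zero_ne_one hp1

theorem MLLT.tendsto_localDensity (h : MLLT ν f τ L p) {φ ψ : M → ℝ} (hφ : Continuous φ)
    (hψ : Continuous ψ) (hφb : ∃ C, ∀ y, |φ y| ≤ C) (hψb : ∃ C, ∀ y, |ψ y| ≤ C)
    (z : Fin d → ℤ) (ζ : Fin d → ℝ) :
    Tendsto (fun n => localDensity ν (fun y => z + tauSum f τ n y) (L n)
      (fun y => φ y * ψ (f^[n] y)) ζ) atTop (𝓝 ((∫ y, φ y ∂ν) * (∫ y, ψ y ∂ν) * p ζ)) := by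
  obtain ⟨hL, -, -, -, hlim⟩ := h
  rw [Metric.tendsto_atTop]
  intro ε hε
  obtain ⟨N, hN⟩ := hlim φ ψ hφ hψ hφb hψb (fun _ => -z)
    (tendsto_pi_nhds.2 fun i => hL.const_div_atTop _) (rnorm ζ) (ε / 2) (half_pos hε)
  refine ⟨N, fun n hn => ?_⟩
  have := hN n hn ζ le_rfl
  simp only [eq_neg_add_iff_add_eq] at this
  rw [Real.dist_eq]
  exact this.trans_lt (half_lt_self hε)

variable [BorelSpace M] [IsProbabilityMeasure ν]

theorem MLLT.tendsto_integral_sub (h : MLLT ν f τ L p) (hf : Measurable f) (hτ : Measurable τ)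
    {φ ψ : M → ℝ} (hφ : Continuous φ) (hψ : Continuous ψ) (hφb : ∃ C, ∀ y, |φ y| ≤ C)
    (hψb : ∃ C, ∀ y, |ψ y| ≤ C) (z : Fin d → ℤ) {s : (Fin d → ℤ) → ℝ} {S : ℝ}
    (hs : ∀ w, |s w| ≤ S) :
    Tendsto (fun n => ∫ y, φ y * ψ (f^[n] y) * s (z + tauSum f τ n y) ∂ν -
      (∫ y, φ y ∂ν) * (∫ y, ψ y ∂ν) * ∫ ζ : Fin d → ℝ, s (fun i => ⌊ζ i * L n⌋) * p ζ)
      atTop (𝓝 0) := by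
  have hp := h.integrable_density
  have hqlim := h.tendsto_localDensity (φ := fun _ => 1) (ψ := fun _ => 1) continuous_const
    continuous_const ⟨1, by simp⟩ ⟨1, by simp⟩ z
  have halim := h.tendsto_localDensity hφ hψ hφb hψb z
  obtain ⟨hL, -, hp0, hp1, -⟩ := h
  obtain ⟨A, hA⟩ := hφb
  obtain ⟨B, hB⟩ := hψb
  set σ : ℕ → M → Fin d → ℤ := fun n y => z + tauSum f τ n y with hσ
  have hσm : ∀ n, Measurable (σ n) := fun n => (measurable_tauSum hf hτ n).const_add z
  have hgm : ∀ n, Measurable fun y => φ y * ψ (f^[n] y) := fun n =>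
    hφ.measurable.mul (hψ.measurable.comp (hf.iterate n))
  have hgb : ∀ n y, |φ y * ψ (f^[n] y)| ≤ |A| * |B| := fun n y => by
    rw [abs_mul]
    exact mul_le_mul ((hA y).trans (le_abs_self _)) ((hB _).trans (le_abs_self _)) (abs_nonneg _)
      (abs_nonneg _)
  have hgi : ∀ n, Integrable (fun y => φ y * ψ (f^[n] y)) ν := fun n =>
    Integrable.of_bound (hgm n).aestronglyMeasurable _ (ae_of_all _ (hgb n))
  have hL0 : ∀ᶠ n in atTop, 0 < L n := hL.eventually_gt_atTop 0
  set c : ℝ := (∫ y, φ y ∂ν) * ∫ y, ψ y ∂ν with hc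
  set a : ℕ → (Fin d → ℝ) → ℝ := fun n =>
    localDensity ν (σ n) (L n) fun y => φ y * ψ (f^[n] y) with ha
  have hai : ∀ᶠ n in atTop, Integrable (a n) := by
    filter_upwards [hL0] with n hn using integrable_localDensity (hσm n) hn (hgm n) (hgi n)
  have hone : Integrable (fun _ : M => (1 : ℝ) * 1) ν := integrable_const _
  have key := tendsto_integral_abs_sub_of_dominated_density (a := a) (c := c) (C := |A| * |B|)
    (q := fun n => localDensity ν (σ n) (L n) fun _ => 1 * 1) hp hp0 ?_ hai (by positivity) ?_
    (fun ζ => by simpa using hqlim ζ) halim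
  · have hbound := key.const_mul S
    rw [mul_zero] at hbound
    refine squeeze_zero_norm' ?_ hbound
    filter_upwards [hL0, hai] with n hn han
    have hsm : Measurable fun ζ : Fin d → ℝ => s fun i => ⌊ζ i * L n⌋ :=
      (measurable_of_countable s).comp (measurable_floor_mul (L n))
    have hmul : ∀ {g : (Fin d → ℝ) → ℝ}, Integrable g →
        Integrable fun ζ => s (fun i => ⌊ζ i * L n⌋) * g ζ := fun hg =>
      hg.bdd_mul hsm.aestronglyMeasurable (ae_of_all _ fun ζ => hs _)
    have hcp : Integrable fun ζ => c * p ζ := hp.const_mul c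
    have h1 : ∫ y, φ y * ψ (f^[n] y) * s (z + tauSum f τ n y) ∂ν =
        ∫ ζ : Fin d → ℝ, s (fun i => ⌊ζ i * L n⌋) * a n ζ :=
      (integral_mul_localDensity (hσm n) hn (hgm n) (hgi n) hs).symm
    have h2 : c * ∫ ζ : Fin d → ℝ, s (fun i => ⌊ζ i * L n⌋) * p ζ =
        ∫ ζ : Fin d → ℝ, s (fun i => ⌊ζ i * L n⌋) * (c * p ζ) := by
      rw [← integral_const_mul]
      simp only [mul_left_comm]
    rw [h1, h2, ← integral_sub (hmul han) (hmul hcp), ← integral_const_mul]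
    refine (norm_integral_le_integral_norm _).trans
      (integral_mono ((hmul han).sub (hmul hcp)).norm ((han.sub hcp).abs.const_mul S) fun ζ => ?_)
    simp only [← mul_sub, Real.norm_eq_abs, abs_mul]
    exact mul_le_mul_of_nonneg_right (hs _) (abs_nonneg _)
  · filter_upwards [hL0] with n hn
    refine ⟨integrable_localDensity (hσm n) hn measurable_const hone, ?_⟩
    have := integral_mul_localDensity (s := fun _ => 1) (C := 1) (hσm n) hn
      (measurable_const (a := (1 : ℝ) * 1)) hone (by simp)
    rw [hp1]
    simpa using this
  · filter_upwards [hL0] with n hn ζ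
    have hset : MeasurableSet {y | σ n y = fun i => ⌊ζ i * L n⌋} :=
      hσm n (measurableSet_singleton _)
    have hi : ∀ {g : M → ℝ}, Integrable g ν →
        Integrable (fun y => if σ n y = fun i => ⌊ζ i * L n⌋ then g y else 0) ν := fun hg =>
      (hg.indicator hset).congr (ae_of_all _ fun y => by simp [Set.indicator])
    simp only [ha, localDensity, abs_mul, abs_of_pos (pow_pos hn d)]
    rw [mul_left_comm]
    refine mul_le_mul_of_nonneg_left ?_ (pow_pos hn d).le
    rw [← integral_const_mul]
    refine abs_integral_le_integral_abs.trans
      (integral_mono (hi (hgi n)).abs ((hi hone).const_mul _) fun y => ?_)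
    dsimp only
    split_ifs
    · simpa using hgb n y
    · simp

end LocalLimit

theorem MeasureTheory.MeasurePreserving.integral_comp_of_measurable {α β : Type*}
    [MeasurableSpace α] [MeasurableSpace β] {μ : Measure α} {ν : Measure β} {f : α → β}
    (hf : MeasurePreserving f μ ν) {g : β → ℝ} (hg : Measurable g) :
    ∫ x, g (f x) ∂μ = ∫ y, g y ∂ν := by
  rw [← hf.map_eq, integral_map hf.measurable.aemeasurable hg.aestronglyMeasurable]

section Ergodicity

variable {d : ℕ} {M : Type*} [MetricSpace M] [MeasurableSpace M] [BorelSpace M] {ν : Measure M}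
  [IsProbabilityMeasure ν] {f : M → M} {τ : M → Fin d → ℤ} {L : ℕ → ℝ} {p : (Fin d → ℝ) → ℝ}

theorem tendsto_integral_mul_of_boundedContinuous {v : ℕ → M → ℝ} (hv : ∀ n, Measurable (v n))
    {C : ℝ} (hC : ∀ n x, |v n x| ≤ C) {c : ℝ}
    (hlim : ∀ g : BoundedContinuousFunction M ℝ,
      Tendsto (fun n => ∫ x, g x * v n x ∂ν) atTop (𝓝 (c * ∫ x, g x ∂ν)))
    {φ : M → ℝ} (hφ : Integrable φ ν) :
    Tendsto (fun n => ∫ x, φ x * v n x ∂ν) atTop (𝓝 (c * ∫ x, φ x ∂ν)) := by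
  refine tendsto_integral_mul_of_approx hv hC hφ fun ε hε => ?_
  obtain ⟨g, hg, hgi⟩ := hφ.exists_boundedContinuous_integral_sub_le hε
  exact ⟨g, hgi, hg, hlim g⟩

theorem MLLT.ergodic (h : MLLT ν f τ L p) (hf : MeasurePreserving f ν ν) (hτ : Measurable τ) :
    Ergodic f ν := by
  refine ⟨hf, ⟨fun {s} hs hinv => ?_⟩⟩
  have hsi : Integrable (s.indicator (1 : M → ℝ)) ν :=
    (integrable_const (1 : ℝ)).indicator hs
  have hsiter : ∀ n y, s.indicator (1 : M → ℝ) (f^[n] y) = s.indicator (1 : M → ℝ) y := by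
    intro n y
    have : y ∈ f^[n] ⁻¹' s ↔ y ∈ s := by
      rw [Set.preimage_iterate_eq, Function.iterate_fixed hinv]
    by_cases hy : y ∈ s
    · simp [hy, show f^[n] y ∈ s from this.2 hy]
    · simp [hy, show f^[n] y ∉ s from fun h => hy (this.1 h)]
  have hprod : ∀ ψ : BoundedContinuousFunction M ℝ,
      ∫ y, ψ y * s.indicator (1 : M → ℝ) y ∂ν = (∫ y, ψ y ∂ν) * ν.real s := by
    intro ψ
    have hψb : ∀ y, |ψ y| ≤ ‖ψ‖ := fun y => ψ.norm_coe_le_norm y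
    have hlim := tendsto_integral_mul_of_boundedContinuous (ν := ν) (v := fun n y => ψ (f^[n] y))
      (fun n => ψ.continuous.measurable.comp (hf.measurable.iterate n)) (C := ‖ψ‖)
      (fun n y => hψb _) (c := ∫ y, ψ y ∂ν) (fun g => by
        have := h.tendsto_integral_sub hf.measurable hτ g.continuous ψ.continuous
          ⟨‖g‖, fun y => g.norm_coe_le_norm y⟩ ⟨‖ψ‖, hψb⟩ 0 (s := fun _ => 1) (S := 1) (by simp)
        obtain ⟨-, -, -, hp1, -⟩ := h
        simp only [mul_one, one_mul, hp1] at this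
        rw [mul_comm]
        exact tendsto_sub_nhds_zero_iff.1 this) hsi
    rw [integral_indicator_one hs] at hlim
    refine tendsto_nhds_unique (tendsto_const_nhds.congr fun n => ?_) hlim
    rw [← (hf.iterate n).integral_comp_of_measurable
      (g := fun y => ψ y * s.indicator (1 : M → ℝ) y)
      (ψ.continuous.measurable.mul (measurable_one.indicator hs))]
    simp only [hsiter, mul_comm]
  have hsq : ν.real s * ν.real s = ν.real s := by
    have h1 := tendsto_integral_mul_of_boundedContinuous (ν := ν)
      (v := fun _ => s.indicator (1 : M → ℝ)) (fun _ => measurable_one.indicator hs) (C := 1)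
      (fun _ y => by by_cases hy : y ∈ s <;> simp [hy]) (c := ν.real s)
      (fun g => by
        rw [hprod g, mul_comm]
        exact tendsto_const_nhds) hsi
    rw [integral_indicator_one hs] at h1
    have h2 := tendsto_nhds_unique h1 tendsto_const_nhds
    rw [h2, ← integral_indicator_one hs]
    refine integral_congr_ae (ae_of_all _ fun y => ?_)
    by_cases hy : y ∈ s <;> simp [hy]
  rw [Filter.eventuallyConst_set']
  rcases IsIdempotentElem.iff_eq_zero_or_one.1 hsq with h0 | h1
  · exact Or.inl (ae_eq_empty.2 ((measureReal_eq_zero_iff).1 h0))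
  · refine Or.inr (ae_eq_univ.2 ?_)
    rw [← measureReal_eq_zero_iff, probReal_compl_eq_one_sub hs, h1, sub_self]

end Ergodicity

section FiniteApproximation

theorem UniformContinuous.exists_finset_approx {M Z : Type*} [MetricSpace M]
    [LocallyCompactSpace M] [MeasurableSpace M] [BorelSpace M] {ν : Measure M}
    [IsProbabilityMeasure ν] {f : M → M} (hf : Ergodic f ν) [UniformSpace Z] [Countable Z]
    {Φ : M × Z → ℝ} (hΦ : UniformContinuous Φ) {C : ℝ} (hC : ∀ x, |Φ x| ≤ C) {ε : ℝ}
    (hε : 0 < ε) :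
    ∃ (F : Finset (Z → ℝ)) (ψ : (Z → ℝ) → BoundedContinuousFunction M ℝ) (S : ℝ) (e : M → ℝ),
      (∀ s ∈ F, ∀ w, |s w| ≤ S) ∧ Measurable e ∧ Integrable e ν ∧ ∫ y, e y ∂ν ≤ ε ∧
        ∀ y w, |Φ (y, w) - ∑ s ∈ F, ψ s y * s w| ≤ e y := by
  classical
  have hε3 : 0 < ε / 3 := by positivity
  obtain ⟨h, hh, hhΦ, D, hD, hhD⟩ := hΦ.exists_countable_approx hf hε3
  set S : ℝ := |C| + ε / 3 with hS
  have hS0 : 0 < S := by positivity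
  obtain ⟨u, hu⟩ : ∃ u : ℕ → Z → ℝ, D = Set.range u := hD.exists_eq_range <| by
    obtain ⟨y, hy⟩ := hhD.exists
    exact ⟨_, hy⟩
  have hFlim : Tendsto (fun n => ν.real (h ⁻¹' ↑((Finset.range n).image u))ᶜ) atTop (𝓝 0) := by
    have h0 : ν (⋂ n, (h ⁻¹' ↑((Finset.range n).image u))ᶜ) = 0 := by
      refine measure_mono_null ?_ hhD
      intro y hy hyD
      obtain ⟨k, hk⟩ := hu ▸ hyD
      refine Set.mem_iInter.1 hy (k + 1) ?_
      simp only [Set.mem_preimage, Finset.coe_image, ← hk]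
      exact ⟨k, by simp, rfl⟩
    have := tendsto_measure_iInter_atTop (μ := ν)
      (s := fun n => (h ⁻¹' ↑((Finset.range n).image u))ᶜ)
      (fun n => (hh _).compl.nullMeasurableSet) (fun m n hmn => Set.compl_subset_compl.2
        (Set.preimage_mono (Finset.coe_subset.2 (Finset.image_subset_image
          (Finset.range_mono hmn))))) ⟨0, measure_ne_top _ _⟩
    rw [h0] at this
    exact (ENNReal.tendsto_toReal ENNReal.zero_ne_top).comp this
  obtain ⟨n, hn⟩ := (hFlim.eventually_le_const (show 0 < ε / 3 / (|C| + 1) by positivity)).exists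
  set F₀ : Finset (Z → ℝ) := (Finset.range n).image u with hF₀
  set F : Finset (Z → ℝ) := F₀.filter fun s => ∀ w, |s w| ≤ S with hF
  have hhS : ∀ y w, |h y w| ≤ S := fun y w => by
    have h1 := hhΦ y w
    have h2 := (hC (y, w)).trans (le_abs_self C)
    rw [abs_sub_comm] at h1
    have := abs_sub_abs_le_abs_sub (h y w) (Φ (y, w))
    linarith
  have hFF₀ : ∀ y, h y ∈ F ↔ h y ∈ F₀ := fun y => by simp [hF, hhS]
  have hQ : ∀ s, MeasurableSet (h ⁻¹' {s}) := fun s => hh _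
  have hQi : ∀ s, Integrable ((h ⁻¹' {s}).indicator (1 : M → ℝ)) ν := fun s =>
    (integrable_const (1 : ℝ)).indicator (hQ s)
  have hη : 0 < ε / 3 / (S * (F.card + 1)) := by positivity
  choose ψ hψ hψi using fun s => (hQi s).exists_boundedContinuous_integral_sub_le hη
  set e : M → ℝ := fun y => ε / 3 +
    (∑ s ∈ F, S * |(h ⁻¹' {s}).indicator (1 : M → ℝ) y - ψ s y|) +
      |C| * (h ⁻¹' (↑F₀ : Set (Z → ℝ)))ᶜ.indicator (1 : M → ℝ) y with he
  have hei0 : ∀ s, Integrable (fun y =>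
      S * |(h ⁻¹' {s}).indicator (1 : M → ℝ) y - ψ s y|) ν := fun s =>
    ((hQi s).sub (hψi s)).abs.const_mul S
  have hei1 : Integrable (fun y =>
      ∑ s ∈ F, S * |(h ⁻¹' {s}).indicator (1 : M → ℝ) y - ψ s y|) ν :=
    integrable_finsetSum _ fun s _ => hei0 s
  have hei2 : Integrable (fun y =>
      |C| * (h ⁻¹' (↑F₀ : Set (Z → ℝ)))ᶜ.indicator (1 : M → ℝ) y) ν :=
    ((integrable_const (1 : ℝ)).indicator (hh _).compl).const_mul _
  have hei3 : Integrable (fun y => ε / 3 +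
      ∑ s ∈ F, S * |(h ⁻¹' {s}).indicator (1 : M → ℝ) y - ψ s y|) ν :=
    (integrable_const _).add hei1
  refine ⟨F, ψ, S, e, fun s hs => (Finset.mem_filter.1 hs).2, ?_,
    hei3.add hei2, ?_, fun y w => ?_⟩
  · refine (measurable_const.add (Finset.measurable_fun_sum _ fun s _ => ?_)).add
      ((measurable_one.indicator (hh _).compl).const_mul _)
    exact (((measurable_one.indicator (hQ s)).sub (ψ s).continuous.measurable).abs).const_mul S
  · simp only [he]
    rw [integral_add hei3 hei2, integral_add (integrable_const _) hei1,
      integral_finsetSum _ fun s _ => hei0 s, integral_const_mul,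
      integral_indicator_one (hh _).compl]
    have h1 : ∑ s ∈ F, ∫ y, S * |(h ⁻¹' {s}).indicator (1 : M → ℝ) y - ψ s y| ∂ν ≤ ε / 3 := by
      calc _ ≤ ∑ s ∈ F, S * (ε / 3 / (S * (F.card + 1))) := by
            refine Finset.sum_le_sum fun s _ => ?_
            rw [integral_const_mul]
            exact mul_le_mul_of_nonneg_left (hψ s) hS0.le
        _ = F.card / (F.card + 1) * (ε / 3) := by
            rw [Finset.sum_const, nsmul_eq_mul]
            field_simp
        _ ≤ 1 * (ε / 3) := by
            refine mul_le_mul_of_nonneg_right ?_ hε3.le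
            rw [div_le_one (by positivity)]
            linarith
        _ = ε / 3 := one_mul _
    have h2 : |C| * ν.real (h ⁻¹' (↑F₀ : Set (Z → ℝ)))ᶜ ≤ ε / 3 := by
      calc _ ≤ (|C| + 1) * (ε / 3 / (|C| + 1)) :=
            mul_le_mul (by linarith) hn measureReal_nonneg (by positivity)
        _ = ε / 3 := by field_simp
    simp only [integral_const, probReal_univ, one_smul]
    linarith
  · have hsum : |∑ s ∈ F, ((h ⁻¹' {s}).indicator (1 : M → ℝ) y - ψ s y) * s w| ≤
        ∑ s ∈ F, S * |(h ⁻¹' {s}).indicator (1 : M → ℝ) y - ψ s y| := by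
      refine (Finset.abs_sum_le_sum_abs _ _).trans (Finset.sum_le_sum fun s hs => ?_)
      rw [abs_mul, mul_comm]
      exact mul_le_mul_of_nonneg_right ((Finset.mem_filter.1 hs).2 w) (abs_nonneg _)
    have hdecomp : Φ (y, w) - ∑ s ∈ F, ψ s y * s w =
        (Φ (y, w) - ∑ s ∈ F, (h ⁻¹' {s}).indicator (1 : M → ℝ) y * s w) +
          ∑ s ∈ F, ((h ⁻¹' {s}).indicator (1 : M → ℝ) y - ψ s y) * s w := by
      simp only [sub_mul, Finset.sum_sub_distrib]
      ring
    have hind : ∑ s ∈ F, (h ⁻¹' {s}).indicator (1 : M → ℝ) y * s w =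
        if h y ∈ F then h y w else 0 := by
      rw [← Finset.sum_ite_eq F (h y) fun s => s w]
      refine Finset.sum_congr rfl fun s _ => ?_
      by_cases hs : h y = s <;> simp [hs]
    rw [hdecomp, hind]
    refine (abs_add_le _ _).trans ?_
    simp only [he]
    by_cases hy : h y ∈ F
    · rw [if_pos hy]
      have := hhΦ y w
      rw [Set.indicator_of_notMem (by simpa using (hFF₀ y).1 hy), mul_zero]
      linarith
    · rw [if_neg hy, sub_zero]
      have := (hC (y, w)).trans (le_abs_self C)
      rw [Set.indicator_of_mem (by simpa using fun h => hy ((hFF₀ y).2 h)), Pi.one_apply, mul_one]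
      linarith

end FiniteApproximation

section BoxAverage

variable {d : ℕ}

/-- The lattice points of a box. -/
def latticeBox (a b : Fin d → ℝ) : Set (Fin d → ℤ) :=
  {w | ∀ i, a i ≤ (w i : ℝ) ∧ (w i : ℝ) ≤ b i}

theorem finite_latticeBox (a b : Fin d → ℝ) : (latticeBox a b).Finite :=
  (Set.finite_Icc (fun i => ⌈a i⌉) fun i => ⌊b i⌋).subset fun _ hw =>
    ⟨fun i => Int.ceil_le.2 (hw i).1, fun i => Int.le_floor.2 (hw i).2⟩

theorem measurable_of_continuous_prod {M Z : Type*} [TopologicalSpace M] [MeasurableSpace M]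
    [BorelSpace M] [TopologicalSpace Z] [MeasurableSpace Z] [Countable Z]
    [MeasurableSingletonClass Z] {Φ : M × Z → ℝ} (hΦ : Continuous Φ) : Measurable Φ :=
  measurable_from_prod_countable_left fun z => (hΦ.comp (by fun_prop)).measurable

theorem setIntegral_VBox {M : Type*} [MeasurableSpace M] {ν : Measure M} [IsProbabilityMeasure ν]
    {Φ : M × (Fin d → ℤ) → ℝ} (hΦ : Measurable Φ) {C : ℝ} (hC : ∀ x, |Φ x| ≤ C)
    (a b : Fin d → ℝ) :
    ∫ x in VBox M a b, Φ x ∂(skewMeas ν) =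
      ∫ w, (latticeBox a b).indicator (fun w => ∫ y, Φ (y, w) ∂ν) w ∂Measure.count := by
  have hbox : VBox M a b = Set.univ ×ˢ latticeBox a b := by
    ext x
    simp [VBox, latticeBox]
  have hfin : IsFiniteMeasure ((Measure.count : Measure (Fin d → ℤ)).restrict (latticeBox a b)) :=
    ⟨by simpa using Measure.count_apply_lt_top.2 (finite_latticeBox a b)⟩
  rw [hbox, skewMeas, ← Measure.prod_restrict, Measure.restrict_univ,
    integral_prod_symm _ (Integrable.of_bound hΦ.aestronglyMeasurable C (ae_of_all _ hC)),
    integral_indicator (finite_latticeBox a b).measurableSet]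

theorem floor_mem_latticeBox_subset {a b ζ : Fin d → ℝ} {L : ℝ} (hL : 1 ≤ L)
    (h : (fun i => ⌊ζ i * L⌋) ∈ latticeBox (fun i => a i * L) fun i => b i * L) :
    ζ ∈ Set.Icc a fun i => b i + 1 := by
  have hL0 : 0 < L := by linarith
  refine ⟨fun i => ?_, fun i => ?_⟩
  · exact le_of_mul_le_mul_right ((h i).1.trans (Int.floor_le _)) hL0
  · have h1 := (Int.lt_floor_add_one (ζ i * L)).le
    have h2 := (h i).2
    refine le_of_mul_le_mul_right (?_ : _ ≤ (b i + 1) * L) hL0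
    dsimp only at h2
    linarith

theorem ae_eventually_floor_mem_latticeBox_iff {L : ℕ → ℝ} (hL : Tendsto L atTop atTop)
    (a b : Fin d → ℝ) :
    ∀ᵐ ζ : Fin d → ℝ, ∀ᶠ n in atTop,
      (fun i => ⌊ζ i * L n⌋) ∈ latticeBox (fun i => a i * L n) (fun i => b i * L n) ↔
        ζ ∈ Set.Icc a b := by
  have hne : ∀ᵐ ζ : Fin d → ℝ, ∀ i, ζ i ≠ a i := by
    rw [ae_all_iff]
    intro i
    rw [ae_iff]
    simpa only [ne_eq, not_not, volume_pi] using
      Measure.pi_hyperplane (fun _ : Fin d => (volume : Measure ℝ)) i (a i)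
  filter_upwards [hne] with ζ hζ
  have hcoord : ∀ i, ∀ᶠ n in atTop,
      (a i * L n ≤ (⌊ζ i * L n⌋ : ℝ) ∧ (⌊ζ i * L n⌋ : ℝ) ≤ b i * L n) ↔ a i ≤ ζ i ∧ ζ i ≤ b i := by
    intro i
    have hlarge : ∀ c : ℝ, 0 < c → ∀ᶠ n in atTop, 1 < c * L n := fun c hc =>
      (hL.const_mul_atTop hc).eventually_gt_atTop 1
    have h1 : ∀ᶠ n in atTop, a i * L n ≤ (⌊ζ i * L n⌋ : ℝ) ↔ a i ≤ ζ i := by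
      rcases lt_or_gt_of_ne (hζ i) with h | h
      · filter_upwards [hL.eventually_gt_atTop 0] with n hn
        refine iff_of_false (not_le.2 ?_) (not_le.2 h)
        exact (Int.floor_le _).trans_lt (mul_lt_mul_of_pos_right h hn)
      · filter_upwards [hlarge _ (sub_pos.2 h)] with n hn
        refine iff_of_true ?_ h.le
        have := Int.lt_floor_add_one (ζ i * L n)
        linarith
    have h2 : ∀ᶠ n in atTop, (⌊ζ i * L n⌋ : ℝ) ≤ b i * L n ↔ ζ i ≤ b i := by
      rcases le_or_gt (ζ i) (b i) with h | h
      · filter_upwards [hL.eventually_gt_atTop 0] with n hn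
        exact iff_of_true ((Int.floor_le _).trans (mul_le_mul_of_nonneg_right h hn.le)) h
      · filter_upwards [hlarge _ (sub_pos.2 h)] with n hn
        refine iff_of_false (not_le.2 ?_) (not_le.2 h)
        have := Int.lt_floor_add_one (ζ i * L n)
        linarith
    filter_upwards [h1, h2] with n hn1 hn2
    rw [hn1, hn2]
  filter_upwards [eventually_all.2 hcoord] with n hn
  simp only [latticeBox, Set.mem_ofPred_eq, hn]
  simp only [Set.mem_Icc, Pi.le_def, forall_and]

variable {M : Type*} [MetricSpace M] [MeasurableSpace M] [BorelSpace M] {ν : Measure M}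
  [IsProbabilityMeasure ν]

theorem memGO.tendsto_setIntegral_Icc {Φ : M × (Fin d → ℤ) → ℝ} {Φbar : ℝ}
    (h : memGO (skewMeas ν) Φ Φbar) {L : ℕ → ℝ} (hL : Tendsto L atTop atTop) {a b : Fin d → ℝ}
    (hab : ∀ i, a i < b i) :
    Tendsto (fun n => ∫ ζ in Set.Icc a b, ((∫ y, Φ (y, fun i => ⌊ζ i * L n⌋) ∂ν) - Φbar))
      atTop (𝓝 0) := by
  obtain ⟨⟨C, hC⟩, hΦ, hlim⟩ := h
  have hΦm : Measurable Φ := measurable_of_continuous_prod hΦ.continuous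
  set P : (Fin d → ℤ) → ℝ := fun w => ∫ y, Φ (y, w) ∂ν with hP
  have hPb : ∀ w, |P w| ≤ C := fun w => by
    simpa [Real.norm_eq_abs] using norm_integral_le_of_norm_le_const (μ := ν)
      (f := fun y => Φ (y, w)) (C := C) (ae_of_all _ fun y => hC (y, w))
  have hPm : ∀ n, Measurable fun ζ : Fin d → ℝ => P fun i => ⌊ζ i * L n⌋ := fun n =>
    (measurable_of_countable P).comp (measurable_floor_mul (L n))
  have hprod : ∏ i, (b i - a i) = volume.real (Set.Icc a b) :=
    (Real.volume_Icc_pi_toReal fun i => (hab i).le).symm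
  have hprod0 : 0 < ∏ i, (b i - a i) := Finset.prod_pos fun i _ => sub_pos.2 (hab i)
  set W : ℕ → Set (Fin d → ℤ) := fun n => latticeBox (fun i => a i * L n) fun i => b i * L n with hW
  have hbox : Tendsto (fun n => ∫ ζ : Fin d → ℝ, (W n).indicator P fun i => ⌊ζ i * L n⌋) atTop
      (𝓝 (Φbar * ∏ i, (b i - a i))) := by
    refine (((hlim a b hab).comp hL).mul_const (∏ i, (b i - a i))).congr' ?_
    filter_upwards [hL.eventually_gt_atTop 0] with n hn
    rw [integral_comp_floor_mul hn ((W n).indicator P), Function.comp_apply,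
      setIntegral_VBox hΦm hC]
    change _ * (∫ w, (W n).indicator P w ∂Measure.count) * _ = _
    generalize (∫ w, (W n).indicator P w ∂Measure.count) = I
    field_simp
  have hdiff : Tendsto (fun n => ∫ ζ : Fin d → ℝ, ((W n).indicator P (fun i => ⌊ζ i * L n⌋) -
      (Set.Icc a b).indicator (fun ζ => P fun i => ⌊ζ i * L n⌋) ζ)) atTop (𝓝 0) := by
    rw [← integral_zero (Fin d → ℝ) ℝ]
    refine tendsto_integral_filter_of_dominated_convergence
      ((Set.Icc a fun i => b i + 1).indicator fun _ => C) (.of_forall fun n => ?_) ?_ ?_ ?_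
    · exact (((measurable_of_countable ((W n).indicator P)).comp (measurable_floor_mul (L n))).sub
        ((hPm n).indicator measurableSet_Icc)).aestronglyMeasurable
    · filter_upwards [hL.eventually_ge_atTop 1] with n hn
      refine ae_of_all _ fun ζ => ?_
      have hsub : ζ ∈ Set.Icc a b → ζ ∈ Set.Icc a fun i => b i + 1 := fun hζ =>
        ⟨hζ.1, fun i => (hζ.2 i).trans (by linarith)⟩
      have hsub' := floor_mem_latticeBox_subset (a := a) (b := b) (ζ := ζ) hn
      have hC0 : 0 ≤ C := (abs_nonneg _).trans (hPb 0)
      by_cases h1 : (fun i => ⌊ζ i * L n⌋) ∈ W n <;> by_cases h2 : ζ ∈ Set.Icc a b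
      · simp only [h1, h2, hsub h2, Set.indicator_of_mem, sub_self, norm_zero, hC0]
      · simpa only [h1, h2, hsub' h1, Set.indicator_of_mem, Set.indicator_of_notMem,
          not_false_eq_true, sub_zero, Real.norm_eq_abs] using hPb _
      · simpa only [h1, h2, hsub h2, Set.indicator_of_mem, Set.indicator_of_notMem,
          not_false_eq_true, zero_sub, norm_neg, Real.norm_eq_abs] using hPb _
      · simpa only [h1, h2, Set.indicator_of_notMem, not_false_eq_true, sub_self, norm_zero] using
          Set.indicator_nonneg (fun _ _ => hC0) ζ
    · exact (integrable_indicator_iff measurableSet_Icc).2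
        (integrableOn_const isCompact_Icc.measure_ne_top)
    · filter_upwards [ae_eventually_floor_mem_latticeBox_iff hL a b] with ζ hζ
      refine tendsto_const_nhds.congr' ?_
      filter_upwards [hζ] with n hn
      by_cases h2 : ζ ∈ Set.Icc a b
      · have h1 : (fun i => ⌊ζ i * L n⌋) ∈ W n := hn.2 h2
        rw [Set.indicator_of_mem h1, Set.indicator_of_mem h2, sub_self]
      · have h1 : (fun i => ⌊ζ i * L n⌋) ∉ W n := fun h => h2 (hn.1 h)
        rw [Set.indicator_of_notMem h1, Set.indicator_of_notMem h2, sub_self]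
  have hconst : ∫ _ in Set.Icc a b, Φbar = Φbar * ∏ i, (b i - a i) := by
    rw [setIntegral_const, hprod, smul_eq_mul, mul_comm]
  have key := (hbox.sub hdiff).sub_const (Φbar * ∏ i, (b i - a i))
  rw [sub_zero, sub_self] at key
  refine key.congr' ?_
  filter_upwards [hL.eventually_gt_atTop 0] with n hn
  have hIcc : IntegrableOn (fun ζ : Fin d → ℝ => P fun i => ⌊ζ i * L n⌋) (Set.Icc a b) :=
    Measure.integrableOn_of_bounded (M := C) isCompact_Icc.measure_ne_top
      (hPm n).aestronglyMeasurable (ae_of_all _ fun ζ => hPb _)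
  have hW1 : Integrable ((W n).indicator P) Measure.count := by
    refine (integrable_indicator_iff (finite_latticeBox _ _).measurableSet).2 ?_
    exact Measure.integrableOn_of_bounded (M := C)
      (Measure.count_apply_lt_top.2 (finite_latticeBox _ _)).ne
      (measurable_of_countable P).aestronglyMeasurable (ae_of_all _ hPb)
  rw [integral_sub (integrable_comp_floor_mul hn hW1) (hIcc.integrable_indicator measurableSet_Icc),
    sub_sub_cancel, integral_indicator measurableSet_Icc,
    integral_sub hIcc (integrableOn_const isCompact_Icc.measure_ne_top), hconst]

end BoxAverage

theorem abs_integral_le_of_abs_le {α : Type*} [MeasurableSpace α] {μ : Measure α} {u v : α → ℝ}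
    (hv : Integrable v μ) (h : ∀ x, |u x| ≤ v x) : |∫ x, u x ∂μ| ≤ ∫ x, v x ∂μ :=
  norm_integral_le_of_norm_le (f := u) hv (ae_of_all _ h)

section LocalGlobalMixing

variable {d : ℕ} {M : Type*} [MetricSpace M] [MeasurableSpace M] [BorelSpace M] {ν : Measure M}
  [IsProbabilityMeasure ν] {f : M → M} {τ : M → Fin d → ℤ} {L : ℕ → ℝ} {p : (Fin d → ℝ) → ℝ}

theorem MLLT.tendsto_integral_sub_sum (h : MLLT ν f τ L p) (hf : Measurable f)
    (hτ : Measurable τ) (g : BoundedContinuousFunction M ℝ) (z : Fin d → ℤ)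
    {F : Finset ((Fin d → ℤ) → ℝ)} (ψ : ((Fin d → ℤ) → ℝ) → BoundedContinuousFunction M ℝ) {S : ℝ}
    (hS : ∀ s ∈ F, ∀ w, |s w| ≤ S) :
    Tendsto (fun n => ∫ y, g y * ∑ s ∈ F, ψ s (f^[n] y) * s (z + tauSum f τ n y) ∂ν -
      (∫ y, g y ∂ν) *
        ∫ ζ : Fin d → ℝ, (∑ s ∈ F, (∫ y, ψ s y ∂ν) * s (fun i => ⌊ζ i * L n⌋)) * p ζ)
      atTop (𝓝 0) := by
  have hb : ∀ k : BoundedContinuousFunction M ℝ, ∃ C, ∀ y, |k y| ≤ C := fun k =>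
    ⟨‖k‖, fun y => k.norm_coe_le_norm y⟩
  have hsum := tendsto_finsetSum F fun s hs =>
    h.tendsto_integral_sub hf hτ g.continuous (ψ s).continuous (hb g) (hb (ψ s)) z (hS s hs)
  rw [Finset.sum_const_zero] at hsum
  refine hsum.congr fun n => ?_
  have h1 : ∀ s ∈ F, Integrable (fun y => g y * ψ s (f^[n] y) * s (z + tauSum f τ n y)) ν := by
    intro s hs
    have hm : Measurable fun y => s (z + tauSum f τ n y) :=
      (measurable_of_countable s).comp ((measurable_tauSum hf hτ n).const_add z)
    have hψ : Measurable fun y => ψ s (f^[n] y) := (ψ s).continuous.measurable.comp (hf.iterate n)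
    refine ((g.integrable ν).mul_bdd (c := ‖ψ s‖) hψ.aestronglyMeasurable
      (ae_of_all _ fun y => (ψ s).norm_coe_le_norm _)).mul_bdd (c := S) hm.aestronglyMeasurable
      (ae_of_all _ fun y => hS s hs _)
  have h2 : ∀ s ∈ F, Integrable fun ζ : Fin d → ℝ =>
      (∫ y, ψ s y ∂ν) * s (fun i => ⌊ζ i * L n⌋) * p ζ := by
    intro s hs
    have hm : Measurable fun ζ : Fin d → ℝ => s fun i => ⌊ζ i * L n⌋ :=
      (measurable_of_countable s).comp (measurable_floor_mul (L n))
    refine h.integrable_density.bdd_mul (c := |∫ y, ψ s y ∂ν| * S)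
      (hm.const_mul _).aestronglyMeasurable (ae_of_all _ fun ζ => ?_)
    rw [Real.norm_eq_abs, abs_mul]
    exact mul_le_mul_of_nonneg_left (hS s hs _) (abs_nonneg _)
  simp only [Finset.mul_sum, Finset.sum_mul, ← mul_assoc]
  rw [integral_finsetSum F h1, integral_finsetSum F h2, Finset.mul_sum, Finset.sum_sub_distrib]
  congr 1
  refine Finset.sum_congr rfl fun s _ => ?_
  simp only [mul_assoc, integral_const_mul]

variable [LocallyCompactSpace M]

theorem MLLT.tendsto_integral_sub_of_uniformContinuous (h : MLLT ν f τ L p)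
    (hf : MeasurePreserving f ν ν) (hτ : Measurable τ) {Φ : M × (Fin d → ℤ) → ℝ}
    (hΦ : UniformContinuous Φ) {C : ℝ} (hC : ∀ x, |Φ x| ≤ C)
    (g : BoundedContinuousFunction M ℝ) (z : Fin d → ℤ) :
    Tendsto (fun n => ∫ y, g y * Φ (f^[n] y, z + tauSum f τ n y) ∂ν -
      (∫ y, g y ∂ν) * ∫ ζ : Fin d → ℝ, (∫ y, Φ (y, fun i => ⌊ζ i * L n⌋) ∂ν) * p ζ)
      atTop (𝓝 0) := by
  have hΦm : Measurable Φ := measurable_of_continuous_prod hΦ.continuous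
  have hp := h.integrable_density
  have hp0 := h.2.2.1
  have hp1 := h.2.2.2.1
  have hg0 : 0 < ‖g‖ + 1 := by positivity
  rw [Metric.tendsto_nhds]
  intro η hη
  obtain ⟨F, ψ, S, e, hS, hem, hei, heε, hR⟩ := hΦ.exists_finset_approx (h.ergodic hf hτ) hC
    (ε := η / (3 * (‖g‖ + 1))) (by positivity)
  set ε := η / (3 * (‖g‖ + 1)) with hε
  have he0 : ∀ y, 0 ≤ e y := fun y => (abs_nonneg _).trans (hR y 0)
  have hgε : ‖g‖ * ∫ y, e y ∂ν ≤ η / 3 := by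
    calc ‖g‖ * ∫ y, e y ∂ν ≤ (‖g‖ + 1) * ε :=
          mul_le_mul (by linarith) heε (integral_nonneg he0) hg0.le
      _ = η / 3 := by rw [hε]; field_simp
  have hΨi : ∀ w, Integrable (fun y => ∑ s ∈ F, ψ s y * s w) ν := fun w =>
    integrable_finsetSum _ fun s _ => ((ψ s).integrable ν).mul_const _
  have hΦi : ∀ w, Integrable (fun y => Φ (y, w)) ν := fun w =>
    Integrable.of_bound (hΦm.comp (by fun_prop)).aestronglyMeasurable C
      (ae_of_all _ fun y => hC (y, w))
  have hP : ∀ w, |(∫ y, Φ (y, w) ∂ν) - ∑ s ∈ F, (∫ y, ψ s y ∂ν) * s w| ≤ ∫ y, e y ∂ν := by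
    intro w
    have : ∑ s ∈ F, (∫ y, ψ s y ∂ν) * s w = ∫ y, ∑ s ∈ F, ψ s y * s w ∂ν := by
      rw [integral_finsetSum _ fun s _ => ((ψ s).integrable ν).mul_const _]
      simp only [integral_mul_const]
    rw [this, ← integral_sub (hΦi w) (hΨi w)]
    exact abs_integral_le_of_abs_le hei fun y => hR y w
  filter_upwards [Metric.tendsto_nhds.1
    (h.tendsto_integral_sub_sum hf.measurable hτ g z ψ hS) (η / 3) (by positivity)] with n hn
  rw [Real.dist_eq, sub_zero] at hn ⊢
  have hpair : Measurable fun y => (f^[n] y, z + tauSum f τ n y) :=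
    (hf.measurable.iterate n).prodMk ((measurable_tauSum hf.measurable hτ n).const_add z)
  have hΨm : Measurable fun x : M × (Fin d → ℤ) => ∑ s ∈ F, ψ s x.1 * s x.2 :=
    Finset.measurable_fun_sum _ fun s _ => ((ψ s).continuous.measurable.comp measurable_fst).mul
      ((measurable_of_countable s).comp measurable_snd)
  have hen : Integrable (fun y => e (f^[n] y)) ν :=
    ((hf.iterate n).integrable_comp hem.aestronglyMeasurable).2 hei
  have hgΦ : Integrable (fun y => g y * Φ (f^[n] y, z + tauSum f τ n y)) ν :=
    (g.integrable ν).mul_bdd (hΦm.comp hpair).aestronglyMeasurable (ae_of_all _ fun y => hC _)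
  have hbound : ∀ y, |g y * Φ (f^[n] y, z + tauSum f τ n y) -
      g y * ∑ s ∈ F, ψ s (f^[n] y) * s (z + tauSum f τ n y)| ≤ ‖g‖ * e (f^[n] y) := fun y => by
    rw [← mul_sub, abs_mul]
    exact mul_le_mul (g.norm_coe_le_norm y) (hR _ _) (abs_nonneg _) (norm_nonneg _)
  have hdiff : Integrable (fun y => g y * Φ (f^[n] y, z + tauSum f τ n y) -
      g y * ∑ s ∈ F, ψ s (f^[n] y) * s (z + tauSum f τ n y)) ν :=
    (hen.const_mul ‖g‖).mono' (hgΦ.aestronglyMeasurable.sub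
      (g.continuous.measurable.mul (hΨm.comp hpair)).aestronglyMeasurable) (ae_of_all _ hbound)
  have hgΨ : Integrable (fun y => g y * ∑ s ∈ F, ψ s (f^[n] y) * s (z + tauSum f τ n y)) ν := by
    exact (hgΦ.sub hdiff).congr (ae_of_all _ fun y => sub_sub_cancel _ _)
  have h1 : |∫ y, g y * Φ (f^[n] y, z + tauSum f τ n y) ∂ν -
      ∫ y, g y * ∑ s ∈ F, ψ s (f^[n] y) * s (z + tauSum f τ n y) ∂ν| ≤ η / 3 := by
    rw [← integral_sub hgΦ hgΨ]
    refine (abs_integral_le_of_abs_le (hen.const_mul ‖g‖) hbound).trans ?_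
    rwa [integral_const_mul, (hf.iterate n).integral_comp_of_measurable hem]
  have hfloor := measurable_floor_mul (d := d) (L n)
  have hPp : Integrable fun ζ : Fin d → ℝ => (∫ y, Φ (y, fun i => ⌊ζ i * L n⌋) ∂ν) * p ζ := by
    refine hp.bdd_mul (c := C) ((measurable_of_countable fun w => ∫ y, Φ (y, w) ∂ν).comp
      hfloor).aestronglyMeasurable (ae_of_all _ fun ζ => ?_)
    simpa using norm_integral_le_of_norm_le_const (μ := ν)
      (f := fun y => Φ (y, fun i => ⌊ζ i * L n⌋)) (C := C) (ae_of_all _ fun y => hC _)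
  have hbound' : ∀ ζ : Fin d → ℝ, |(∫ y, Φ (y, fun i => ⌊ζ i * L n⌋) ∂ν) * p ζ -
      (∑ s ∈ F, (∫ y, ψ s y ∂ν) * s (fun i => ⌊ζ i * L n⌋)) * p ζ| ≤ (∫ y, e y ∂ν) * p ζ :=
    fun ζ => by
      rw [← sub_mul, abs_mul, abs_of_nonneg (hp0 ζ)]
      exact mul_le_mul_of_nonneg_right (hP _) (hp0 ζ)
  have hΨp : Integrable fun ζ : Fin d → ℝ =>
      (∑ s ∈ F, (∫ y, ψ s y ∂ν) * s (fun i => ⌊ζ i * L n⌋)) * p ζ := by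
    have hm := (measurable_of_countable fun w => ∑ s ∈ F, (∫ y, ψ s y ∂ν) * s w).comp hfloor
    have := (hp.const_mul (∫ y, e y ∂ν)).mono'
      (hPp.aestronglyMeasurable.sub (hm.aestronglyMeasurable.mul hp.aestronglyMeasurable))
      (ae_of_all _ hbound')
    exact (hPp.sub this).congr (ae_of_all _ fun ζ => sub_sub_cancel _ _)
  have h2 : |(∫ y, g y ∂ν) * (∫ ζ : Fin d → ℝ, (∫ y, Φ (y, fun i => ⌊ζ i * L n⌋) ∂ν) * p ζ) -
      (∫ y, g y ∂ν) *
        ∫ ζ : Fin d → ℝ, (∑ s ∈ F, (∫ y, ψ s y ∂ν) * s (fun i => ⌊ζ i * L n⌋)) * p ζ| ≤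
      η / 3 := by
    have hgn : |∫ y, g y ∂ν| ≤ ‖g‖ := by
      simpa using norm_integral_le_of_norm_le_const (μ := ν)
        (ae_of_all _ fun y => g.norm_coe_le_norm y)
    rw [← mul_sub, ← integral_sub hPp hΨp, abs_mul]
    refine (mul_le_mul hgn (abs_integral_le_of_abs_le (hp.const_mul _) hbound')
      (abs_nonneg _) (norm_nonneg _)).trans ?_
    rwa [integral_const_mul, hp1, mul_one]
  rw [abs_le] at h1 h2
  rw [abs_lt] at hn ⊢
  constructor <;> linarith [h1.1, h1.2, h2.1, h2.2, hn.1, hn.2]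

theorem MLLT.tendsto_integral_mul_of_memGO (h : MLLT ν f τ L p) (hf : MeasurePreserving f ν ν)
    (hτ : Measurable τ) {Φ : M × (Fin d → ℤ) → ℝ} {Φbar : ℝ} (hΦ : memGO (skewMeas ν) Φ Φbar)
    (z : Fin d → ℤ) {φ : M → ℝ} (hφ : Integrable φ ν) :
    Tendsto (fun n => ∫ y, φ y * Φ (f^[n] y, z + tauSum f τ n y) ∂ν) atTop
      (𝓝 (Φbar * ∫ y, φ y ∂ν)) := by
  obtain ⟨C, hC⟩ := hΦ.1
  have hΦm : Measurable Φ := measurable_of_continuous_prod hΦ.2.1.continuous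
  have hp := h.integrable_density
  refine tendsto_integral_mul_of_boundedContinuous (fun n => hΦm.comp
    ((hf.measurable.iterate n).prodMk ((measurable_tauSum hf.measurable hτ n).const_add z)))
    (fun n y => hC _) (fun g => ?_) hφ
  have hPm : ∀ n, Measurable fun ζ : Fin d → ℝ => ∫ y, Φ (y, fun i => ⌊ζ i * L n⌋) ∂ν := fun n =>
    (measurable_of_countable fun w => ∫ y, Φ (y, w) ∂ν).comp (measurable_floor_mul (L n))
  have hPb : ∀ n (ζ : Fin d → ℝ), |∫ y, Φ (y, fun i => ⌊ζ i * L n⌋) ∂ν| ≤ C := fun n ζ => by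
    simpa using norm_integral_le_of_norm_le_const (μ := ν)
      (f := fun y => Φ (y, fun i => ⌊ζ i * L n⌋)) (C := C) (ae_of_all _ fun y => hC _)
  have hP0 := tendsto_integral_mul_of_tendsto_Icc (fun n => (hPm n).sub_const Φbar)
    (C := C + |Φbar|) (fun n ζ => (abs_sub _ _).trans (add_le_add_left (hPb n ζ) _))
    (fun a b hab => hΦ.tendsto_setIntegral_Icc h.1 hab) hp
  have hPlim : Tendsto (fun n => ∫ ζ : Fin d → ℝ, (∫ y, Φ (y, fun i => ⌊ζ i * L n⌋) ∂ν) * p ζ)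
      atTop (𝓝 Φbar) := by
    have := hP0.add_const Φbar
    rw [zero_add] at this
    refine this.congr fun n => ?_
    simp only [mul_sub]
    rw [integral_sub (hp.mul_bdd (hPm n).aestronglyMeasurable (ae_of_all _ (hPb n)))
      (hp.mul_const _), integral_mul_const, h.2.2.2.1, one_mul, sub_add_cancel]
    simp only [mul_comm]
  have := (h.tendsto_integral_sub_of_uniformContinuous hf hτ hΦ.2.1 hC g z).add
    (hPlim.const_mul (∫ y, g y ∂ν))
  rw [zero_add, mul_comm] at this
  exact this.congr fun n => sub_add_cancel _ _

end LocalGlobalMixing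

/-- If the skew product `T(y,z) = (f y, z + τ y)` over a probability preserving
system `(M, ν, f)` satisfies the MLLT at some scale `(L_n)`, then `T` is local-global mixing with
respect to `𝔾_O`: for every `φ ∈ L¹(μ)` and every `(Φ, Φ̄) ∈ 𝔾_O`,
`∫ φ · (Φ ∘ T^n) dμ → (∫ φ dμ) · Φ̄`. -/
theorem mllt_implies_local_global_mixing_GO
    {d : ℕ} {M : Type*} [MetricSpace M] [LocallyCompactSpace M]
    [MeasurableSpace M] [BorelSpace M]
    (ν : Measure M) [IsProbabilityMeasure ν]
    (f : M → M) (hf : MeasurePreserving f ν ν)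
    (τ : M → Fin d → ℤ) (hτ : Measurable τ)
    (L : ℕ → ℝ) (p : (Fin d → ℝ) → ℝ)
    (hMLLT : MLLT ν f τ L p)
    (φ : M × (Fin d → ℤ) → ℝ) (hφ : Integrable φ (skewMeas ν))
    (Φ : M × (Fin d → ℤ) → ℝ) (Φbar : ℝ) (hΦ : memGO (skewMeas ν) Φ Φbar) :
    Tendsto (fun n : ℕ => ∫ x, φ x * Φ ((skewT f τ)^[n] x) ∂(skewMeas ν))
      atTop (𝓝 ((∫ x, φ x ∂(skewMeas ν)) * Φbar)) := by
  obtain ⟨C, hC⟩ := hΦ.1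
  have hΦm : Measurable Φ := measurable_of_continuous_prod hΦ.2.1.continuous
  have hpair : ∀ n z, Measurable fun y => (f^[n] y, z + tauSum f τ n y) := fun n z =>
    (hf.measurable.iterate n).prodMk ((measurable_tauSum hf.measurable hτ n).const_add z)
  have hsec : ∀ᵐ z ∂(Measure.count : Measure (Fin d → ℤ)), Integrable (fun y => φ (y, z)) ν :=
    hφ.prod_left_ae
  have hmeas : ∀ n, Measurable fun x : M × (Fin d → ℤ) => Φ ((skewT f τ)^[n] x) := by
    intro n
    refine measurable_from_prod_countable_left fun z => ?_
    simp only [skewT_iterate]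
    exact hΦm.comp (hpair n z)
  have hint : ∀ n, Integrable (fun x => φ x * Φ ((skewT f τ)^[n] x)) (skewMeas ν) := fun n =>
    hφ.mul_bdd (hmeas n).aestronglyMeasurable (ae_of_all _ fun x => hC _)
  have hprod : ∀ n, ∫ x, φ x * Φ ((skewT f τ)^[n] x) ∂(skewMeas ν) =
      ∫ z, ∫ y, φ (y, z) * Φ (f^[n] y, z + tauSum f τ n y) ∂ν ∂Measure.count := by
    intro n
    rw [skewMeas, integral_prod_symm _ (hint n)]
    simp only [skewT_iterate]
  have hlim : (∫ x, φ x ∂(skewMeas ν)) * Φbar =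
      ∫ z, Φbar * ∫ y, φ (y, z) ∂ν ∂Measure.count := by
    rw [skewMeas, integral_prod_symm _ hφ, integral_const_mul, mul_comm]
  simp only [hprod]
  rw [hlim]
  refine tendsto_integral_of_dominated_convergence (fun z => ∫ y, ‖φ (y, z)‖ * C ∂ν)
    (fun n => (measurable_of_countable _).aestronglyMeasurable)
    (hφ.norm.mul_const C).integral_prod_right (fun n => ?_) ?_
  · filter_upwards [hsec] with z hz
    refine norm_integral_le_of_norm_le (hz.norm.mul_const C) (ae_of_all _ fun y => ?_)
    rw [norm_mul]
    exact mul_le_mul_of_nonneg_left (hC _) (norm_nonneg _)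
  · filter_upwards [hsec] with z hz
    exact hMLLT.tendsto_integral_mul_of_memGO hf hτ hΦ z hz
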